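/- There exists an infinite binary sequence that is finite-state strongly predictable but not computable; in particular, for any computable real T ∈ (0,1), Z(T) is such a sequence. -/

import Mathlib

/-- The first `n` bits of the infinite binary sequence `X` (as a finite binary string). -/
def pre (X : ℕ → Bool) (n : ℕ) : List Bool := (List.range n).map X

/-- A martingale: nonnegative betting strategy with the fairness condition. -/
def IsMartingale (B : List Bool → ℝ) : Prop :=
  (∀ x, 0 ≤ B x) ∧ ∀ x, B (x ++ [false]) + B (x ++ [true]) = 2 * B x

/-- `B` succeeds on `X`: the capital along `X` is unbounded. -/
def Succeeds (B : List Bool → ℝ) (X : ℕ → Bool) : Prop := ∀ C : ℝ, ∃ n, C < B (pre X n)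

/-- A computable martingale: `{(x,q) | q < B x}` is decidable. -/
def ComputableMartingale (B : List Bool → ℝ) : Prop :=
  IsMartingale B ∧ ∃ g : List Bool × ℚ → Bool, Computable g ∧
    ∀ p : List Bool × ℚ, g p = true ↔ (p.2 : ℝ) < B p.1

def ComputablyRandom (X : ℕ → Bool) : Prop :=
  ∀ B : List Bool → ℝ, ComputableMartingale B → ¬ Succeeds B X

def TotalStronglyPredictable (X : ℕ → Bool) : Prop :=
  ∃ F : List Bool → Option Bool, Computable F ∧
    (∀ n b, F (pre X n) = some b → b = X n) ∧
    {n : ℕ | F (pre X n) ≠ none}.Infinite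

def StronglyPredictable (X : ℕ → Bool) : Prop :=
  ∃ F : List Bool →. Option Bool, Partrec F ∧
    (∀ n, (F (pre X n)).Dom) ∧
    (∀ n b, some b ∈ F (pre X n) → b = X n) ∧
    {n : ℕ | ∃ b, some b ∈ F (pre X n)}.Infinite

def PartialComputableMartingale (B : List Bool →. ℚ) : Prop :=
  Partrec B ∧
  (∀ x q, q ∈ B x → 0 ≤ q) ∧
  (∀ x y : List Bool, x <+: y → (B y).Dom → (B x).Dom) ∧
  (∀ x : List Bool, (B x).Dom → ((B (x ++ [false])).Dom ↔ (B (x ++ [true])).Dom)) ∧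
  (∀ (x : List Bool) (q q₀ q₁ : ℚ), q ∈ B x → q₀ ∈ B (x ++ [false]) → q₁ ∈ B (x ++ [true]) →
    q₀ + q₁ = 2 * q)

def PSucceeds (B : List Bool →. ℚ) (X : ℕ → Bool) : Prop :=
  (∀ n, (B (pre X n)).Dom) ∧ ∀ C : ℚ, ∃ n, ∃ q ∈ B (pre X n), C < q

def PartialComputablyRandom (X : ℕ → Bool) : Prop :=
  ∀ B : List Bool →. ℚ, PartialComputableMartingale B → ¬ PSucceeds B X

def FiniteStateStronglyPredictable (X : ℕ → Bool) : Prop :=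
  ∃ (Q : Type) (_ : Fintype Q) (δ : Q → Bool → Q) (q₀ : Q) (f : Q → Option Bool),
    (∀ n b, f ((pre X n).foldl δ q₀) = some b → b = X n) ∧
    {n : ℕ | f ((pre X n).foldl δ q₀) ≠ none}.Infinite

/-- A prefix-free machine: a partial computable function with prefix-free domain. -/
def IsPrefixFreeMachine (M : List Bool →. List Bool) : Prop :=
  Partrec M ∧ ∀ p q : List Bool, (M p).Dom → (M q).Dom → p <+: q → p = q

/-- An optimal prefix-free machine. -/
def IsOptimalMachine (U : List Bool →. List Bool) : Prop :=
  IsPrefixFreeMachine U ∧ ∀ M : List Bool →. List Bool, IsPrefixFreeMachine M →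
    ∃ d : ℕ, ∀ p : List Bool, (M p).Dom →
      ∃ q : List Bool, q.length ≤ p.length + d ∧ U q = M p

/-- Program-size (Kolmogorov) complexity of `x` with respect to `U`. -/
noncomputable def KC (U : List Bool →. List Bool) (x : List Bool) : ℕ :=
  sInf {n : ℕ | ∃ p : List Bool, p.length = n ∧ x ∈ U p}

/-- The partition function `Z(T)` of `U` at temperature `T`. -/
noncomputable def ZT (U : List Bool →. List Bool) (T : ℝ) : ℝ :=
  ∑' p : {p : List Bool // (U p).Dom}, (2 : ℝ) ^ (-((p.1.length : ℝ)) / T)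

/-- Chaitin's Ω number of `U`. -/
noncomputable def Omega (U : List Bool →. List Bool) : ℝ :=
  ∑' p : {p : List Bool // (U p).Dom}, (2 : ℝ) ^ (-((p.1.length : ℝ)))

/-- The `n`-th bit (0-indexed) of the base-two expansion (with infinitely many zeros)
of the fractional part of `α`. -/
noncomputable def binDigit (α : ℝ) (n : ℕ) : Bool :=
  decide (⌊α * 2 ^ (n + 1)⌋ % 2 = 1)

def ComputableReal (T : ℝ) : Prop :=
  ∃ f : ℕ → ℚ, Computable f ∧ ∀ n : ℕ, |T - (f n : ℝ)| < (2 : ℝ) ^ (-(n : ℤ))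

def WeaklyChaitinRandom (U : List Bool →. List Bool) (X : ℕ → Bool) : Prop :=
  ∃ c : ℕ, ∀ n : ℕ, 1 ≤ n → (n : ℤ) - c ≤ (KC U (pre X n) : ℤ)

def WeaklyChaitinTRandom (U : List Bool →. List Bool) (T : ℝ) (X : ℕ → Bool) : Prop :=
  ∃ c : ℕ, ∀ n : ℕ, 1 ≤ n → T * n - c ≤ (KC U (pre X n) : ℝ)

def StrictlyTCompressible (U : List Bool →. List Bool) (T : ℝ) (X : ℕ → Bool) : Prop :=
  ∃ d : ℕ, ∀ n : ℕ, 1 ≤ n → (KC U (pre X n) : ℝ) ≤ T * n + d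

def StrictlyChaitinTRandom (U : List Bool →. List Bool) (T : ℝ) (X : ℕ → Bool) : Prop :=
  WeaklyChaitinTRandom U T X ∧ StrictlyTCompressible U T X


theorem pre_succ (X : ℕ → Bool) (n : ℕ) : pre X (n+1) = pre X n ++ [X n] := by
  simp [pre, List.range_succ]

/-- transition function of the zero-run counter -/
def zdelta (N j : ℕ) (s : Fin (N+1) × Fin (j+1)) (b : Bool) : Fin (N+1) × Fin (j+1) :=
  if h : s.1.1 < N then (⟨s.1.1 + 1, by omega⟩, ⟨0, by omega⟩)
  else (s.1, if b then ⟨0, by omega⟩ else ⟨min (s.2.1 + 1) j, by omega⟩)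

theorem fssp_of_no_zero_run (X : ℕ → Bool)
    (h : ∃ k N, ∀ n, N ≤ n → ∃ i, i < k ∧ X (n+i) = true) :
    FiniteStateStronglyPredictable X := by
  classical
  obtain ⟨N, hN⟩ := Nat.find_spec h
  have hmin := fun k hk => Nat.find_min h (m := k) hk
  set k := Nat.find h with hk
  obtain _ | j := k
  · obtain ⟨i, hi, _⟩ := hN N le_rfl
    omega
  have hj := hmin j (by omega)
  push Not at hj
  let S : ℕ → Fin (N+1) × Fin (j+1) := fun n => (pre X n).foldl (zdelta N j) (0, 0)
  have hS : ∀ n, S (n+1) = zdelta N j (S n) (X n) := by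
    intro n; simp [S, pre_succ, List.foldl_append]
  have hS0 : S 0 = (0, 0) := by simp [S, pre]
  have h1 : ∀ n, (S n).1.1 = min n N := by
    intro n
    induction n with
    | zero => simp [hS0]
    | succ n ih =>
      rw [hS, zdelta]
      split_ifs with h1 h2
      · simp; omega
      · simp; omega
      · simp; omega
  have h2 : ∀ n, ((S n).2.1 = 0 ∨ N + (S n).2.1 ≤ n) ∧
      ∀ i, i < n → n ≤ i + (S n).2.1 → X i = false := by
    intro n
    induction n with
    | zero => simp [hS0]
    | succ n ih =>
      have h1n := h1 n
      rw [hS, zdelta]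
      split_ifs with h1 h2
      · refine ⟨by simp, fun i hi hi' => ?_⟩
        simp at hi'; omega
      · refine ⟨by simp, fun i hi hi' => ?_⟩
        simp at hi'; omega
      · simp only
        refine ⟨by omega, fun i hi hi' => ?_⟩
        rcases Nat.lt_or_ge i n with h | h
        · exact ih.2 i h (by omega)
        · have : i = n := by omega
          subst this; simpa using h2
  have h3 : ∀ n s, N ≤ n → (∀ i, i < s → X (n+i) = false) → min s j ≤ (S (n+s)).2.1 := by
    intro n s hn
    induction s with
    | zero => simp
    | succ s ih =>
      intro hs
      have ih' := ih (fun i hi => hs i (by omega))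
      have hX := hs s (by omega)
      have h1n := h1 (n+s)
      rw [← add_assoc, hS, zdelta]
      split_ifs with h1 h2
      · omega
      · simp [hX] at h2
      · simp only; omega
  refine ⟨Fin (N+1) × Fin (j+1), inferInstance, zdelta N j, (0,0),
    fun s => if s.1.1 = N ∧ s.2.1 = j then some true else none, ?_, ?_⟩
  · intro n b hb
    change (if (S n).1.1 = N ∧ (S n).2.1 = j then some true else none) = some b at hb
    split_ifs at hb with hc
    have hb' : b = true := by simpa using hb.symm
    subst hb'
    have h2n := h2 n
    have h1n := h1 n
    rw [hc.2] at h2n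
    have hge : N + j ≤ n := by omega
    obtain ⟨i, hi, hXi⟩ := hN (n - j) (by omega)
    rcases Nat.lt_or_ge i j with h | h
    · have := h2n.2 (n - j + i) (by omega) (by omega)
      rw [this] at hXi; simp at hXi
    · have : n - j + i = n := by omega
      rw [this] at hXi; exact hXi.symm
  · rw [Set.infinite_iff_exists_gt]
    intro a
    obtain ⟨n, hn, hz⟩ := hj (N + a + 1)
    refine ⟨n + j, ?_, by omega⟩
    have h3n := h3 n j (by omega) (fun i hi => by simpa using hz i hi)
    have h1n := h1 (n+j)
    have := (S (n+j)).2.2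
    change (if (S (n+j)).1.1 = N ∧ (S (n+j)).2.1 = j then some true else none) ≠ none
    rw [if_pos ⟨by omega, by omega⟩]
    simp

theorem computable_find {α : Type*} [Primcodable α] {p : α → ℕ → Bool} (hp : Computable₂ p)
    (H : ∀ a, ∃ n, p a n = true) : Computable (fun a => Nat.find (H a)) := by
  have h := Partrec.rfind (hp.partrec₂)
  refine h.of_eq_tot (fun a => ?_)
  rw [Nat.mem_rfind]
  refine ⟨by simpa using (Nat.find_spec (H a)).symm, fun {m} hm => ?_⟩
  have := Nat.find_min (H a) hm
  simpa using this

theorem int_encode_natAbs (z : ℤ) : (Encodable.encode z + 1) / 2 = z.natAbs := by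
  rcases z with n | n
  · change (2 * n + 1) / 2 = n; omega
  · change (2 * n + 1 + 1) / 2 = n + 1; omega

theorem mem_range_ratcode (k : ℕ) : k ∈ Set.range (@Encodable.encode ℚ Rat.instEncodable) ↔
    (0 < k.unpair.2 ∧ ∀ x < k.unpair.2 + 1,
      (k.unpair.2 % x = 0 ∧ ((k.unpair.1 + 1) / 2) % x = 0) → x = 1) := by
  constructor
  · rintro ⟨q, rfl⟩
    change 0 < (Nat.unpair (Nat.pair (Encodable.encode q.num) q.den)).2 ∧ ∀ x < (Nat.unpair (Nat.pair (Encodable.encode q.num) q.den)).2 + 1,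
      ((Nat.unpair (Nat.pair (Encodable.encode q.num) q.den)).2 % x = 0 ∧
      (((Nat.unpair (Nat.pair (Encodable.encode q.num) q.den)).1 + 1) / 2) % x = 0) → x = 1
    rw [Nat.unpair_pair]
    simp only [int_encode_natAbs]
    refine ⟨q.den_pos, fun x _ hx => ?_⟩
    exact Nat.eq_one_of_dvd_coprimes q.reduced (Nat.dvd_of_mod_eq_zero hx.2)
      (Nat.dvd_of_mod_eq_zero hx.1)
  · rintro ⟨h0, h⟩
    set z : ℤ := Denumerable.ofNat ℤ k.unpair.1 with hz
    have hz' : Encodable.encode z = k.unpair.1 := Denumerable.encode_ofNat _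
    have hc : z.natAbs.Coprime k.unpair.2 := by
      rw [Nat.Coprime]
      apply h
      · exact Nat.lt_succ_of_le (Nat.le_of_dvd h0 (Nat.gcd_dvd_right _ _))
      · refine ⟨Nat.mod_eq_zero_of_dvd (Nat.gcd_dvd_right _ _), ?_⟩
        rw [← hz', int_encode_natAbs]
        exact Nat.mod_eq_zero_of_dvd (Nat.gcd_dvd_left _ _)
    refine ⟨⟨z, k.unpair.2, by omega, hc⟩, ?_⟩
    change Nat.pair (Encodable.encode z) k.unpair.2 = k
    rw [hz', Nat.pair_unpair]

theorem primrec_ratcode : PrimrecPred (fun k => k ∈ Set.range (@Encodable.encode ℚ Rat.instEncodable)) := by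
  have h1 : PrimrecRel (fun (x : ℕ) (k : ℕ) => 
      (k.unpair.2 % x = 0 ∧ ((k.unpair.1 + 1) / 2) % x = 0) → x = 1) := by
    have u2 : Primrec (fun p : ℕ × ℕ => p.2.unpair.2) := Primrec.snd.comp (Primrec.unpair.comp Primrec.snd)
    have u1 : Primrec (fun p : ℕ × ℕ => p.2.unpair.1) := Primrec.fst.comp (Primrec.unpair.comp Primrec.snd)
    have a1 : PrimrecPred (fun p : ℕ × ℕ => p.2.unpair.2 % p.1 = 0) :=
      Primrec.eq.comp (Primrec.nat_mod.comp u2 Primrec.fst) (Primrec.const 0)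
    have a2 : PrimrecPred (fun p : ℕ × ℕ => ((p.2.unpair.1 + 1)/2) % p.1 = 0) :=
      Primrec.eq.comp (Primrec.nat_mod.comp (Primrec.nat_div.comp (Primrec.nat_add.comp u1 (Primrec.const 1)) (Primrec.const 2)) Primrec.fst) (Primrec.const 0)
    have a3 : PrimrecPred (fun p : ℕ × ℕ => p.1 = 1) := Primrec.eq.comp Primrec.fst (Primrec.const 1)
    have := ((a1.and a2).not).or a3
    refine PrimrecPred.of_eq this (fun p => ?_)
    tauto
  have h2 := h1.forall_lt
  have u2 : Primrec (fun k : ℕ => k.unpair.2) := Primrec.snd.comp Primrec.unpair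
  have h3 : PrimrecPred (fun k : ℕ => ∀ x < k.unpair.2 + 1,
      (k.unpair.2 % x = 0 ∧ ((k.unpair.1 + 1) / 2) % x = 0) → x = 1) :=
    h2.comp (Primrec.nat_add.comp u2 (Primrec.const 1)) Primrec.id
  have h4 : PrimrecPred (fun k : ℕ => 0 < k.unpair.2) := Primrec.nat_lt.comp (Primrec.const 0) u2
  exact (h4.and h3).of_eq (fun k => (mem_range_ratcode k).symm)

open Encodable in
theorem computable_ratcode :
    Computable (fun q : ℚ => @Encodable.encode ℚ Rat.instEncodable q) := by
  classical
  let S := Set.range (@Encodable.encode ℚ Rat.instEncodable)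
  let _ : DecidablePred (· ∈ S) := Encodable.decidableRangeEncode ℚ
  have _ : Infinite S := Infinite.of_injective _ (Equiv.ofInjective _ Encodable.encode_injective).injective
  have hofnat : ∀ n, @Encodable.encode ℚ Rat.instEncodable (Denumerable.ofNat ℚ n)
      = (Nat.Subtype.ofNat S n).1 := by
    intro n
    have : Denumerable.ofNat ℚ n = (Encodable.equivRangeEncode ℚ).symm (Nat.Subtype.ofNat S n) := rfl
    rw [this]
    have h2 := (Encodable.equivRangeEncode ℚ).apply_symm_apply (Nat.Subtype.ofNat S n)
    exact congrArg Subtype.val h2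
  have H : ∀ x : ℕ, ∃ m, decide ((x + m + 1) ∈ S) = true := by
    intro x
    have hinf : S.Infinite := Set.infinite_coe_iff.mp inferInstance
    obtain ⟨y, hy, hxy⟩ := hinf.exists_gt x
    exact ⟨y - x - 1, by rw [decide_eq_true_eq]; convert hy using 1; omega⟩
  have hp : Computable₂ (fun x m : ℕ => decide ((x + m + 1) ∈ S)) := by
    have : Primrec₂ (fun x m : ℕ => (x + m + 1)) :=
      Primrec.nat_add.comp (Primrec.nat_add.comp Primrec.fst Primrec.snd) (Primrec.const 1)
    exact (primrec_ratcode.decide.comp this).to_comp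
  have hnext := computable_find hp H
  have hnx : Computable (fun x => x + Nat.find (H x) + 1) :=
    (Primrec.nat_add.to_comp).comp ((Primrec.nat_add.to_comp).comp Computable.id hnext) (Computable.const 1)
  have hrec : Computable (fun n : ℕ => Nat.rec (motive := fun _ => ℕ) (Nat.Subtype.ofNat S 0).1
      (fun _ x => x + Nat.find (H x) + 1) n) :=
    Computable.nat_rec Computable.id (Computable.const _)
      (hnx.comp (Computable.snd.comp Computable.snd)).to₂
  have hh : Computable (fun n => (Nat.Subtype.ofNat S n).1) := by
    refine hrec.of_eq (fun n => ?_)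
    induction n with
    | zero => rfl
    | succ n ih =>
      change _ + Nat.find (H _) + 1 = _
      simp only [ih]
      change _ = (Nat.Subtype.ofNat S n).1 + Nat.find _ + 1
      congr 2
      simp
  have := hh.comp (Computable.encode (α := ℚ))
  refine this.of_eq (fun q => ?_)
  rw [← hofnat]
  exact congrArg _ (Denumerable.ofNat_encode q)

theorem computable_rat_num_den {f : ℕ → ℚ} (hf : Computable f) :
    Computable (fun n => (f n).num.natAbs) ∧ Computable (fun n => (f n).den) := by
  have h := computable_ratcode.comp hf
  have hu := Computable.unpair.comp h
  have e : ∀ n, (@Encodable.encode ℚ Rat.instEncodable (f n)).unpair = (Encodable.encode (f n).num, (f n).den) := by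
    intro n
    change (Nat.pair (Encodable.encode (f n).num) (f n).den).unpair = _
    rw [Nat.unpair_pair]
  constructor
  · refine (((Primrec.nat_div.comp (Primrec.nat_add.comp Primrec.id (Primrec.const 1)) (Primrec.const 2)).to_comp).comp
      (Computable.fst.comp hu)).of_eq (fun n => ?_)
    simp only [e, id]
    exact int_encode_natAbs _
  · refine (Computable.snd.comp hu).of_eq (fun n => ?_)
    simp only [e]

theorem primrec_pow : Primrec₂ ((· ^ ·) : ℕ → ℕ → ℕ) := Primrec₂.unpaired'.1 Nat.Primrec.pow

def bval (p : List Bool) : ℕ := p.foldl (fun a b => 2 * a + b.toNat) 0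

theorem bval_append_one (p : List Bool) (b : Bool) : bval (p ++ [b]) = 2 * bval p + b.toNat := by
  simp [bval]

theorem bval_append (p s : List Bool) :
    bval p * 2 ^ s.length ≤ bval (p ++ s) ∧ bval (p ++ s) < (bval p + 1) * 2 ^ s.length := by
  induction s using List.reverseRecOn with
  | nil => simp
  | append_singleton s b ih =>
    rw [← List.append_assoc, bval_append_one]
    have : b.toNat ≤ 1 := by cases b <;> simp
    simp only [List.length_append, List.length_singleton, pow_succ]
    constructor <;> nlinarith [ih.1, ih.2]

theorem exists_bval (l : ℕ) : ∀ b, b < 2 ^ l → ∃ p : List Bool, p.length = l ∧ bval p = b := by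
  induction l with
  | zero => intro b hb; exact ⟨[], rfl, by simp at hb; simp [bval, hb]⟩
  | succ l ih =>
    intro b hb
    obtain ⟨p, hp, hv⟩ := ih (b / 2) (by rw [pow_succ] at hb; omega)
    refine ⟨p ++ [b.bodd], by simp [hp], ?_⟩
    rw [bval_append_one, hv]
    have := Nat.bodd_add_div2 b
    rw [Nat.div2_val] at this
    omega

def cw (s : ℕ × ℕ) (l : ℕ) : ℕ := (s.1 * 2 ^ l + 2 ^ s.2 - 1) / 2 ^ s.2

def kcst (len : ℕ → Option ℕ) : ℕ → ℕ × ℕ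
  | 0 => (0, 0)
  | r + 1 => Option.casesOn (len r) (kcst len r) (fun l => (cw (kcst len r) l + 1, l))

noncomputable def wl (o : Option ℕ) : ℝ := o.elim 0 (fun l => (1/2) ^ l)

theorem cw_ge (s : ℕ × ℕ) (l : ℕ) : (s.1 : ℝ) / 2 ^ s.2 ≤ cw s l / 2 ^ l := by
  rw [div_le_div_iff₀ (by positivity) (by positivity)]
  have h : s.1 * 2 ^ l ≤ cw s l * 2 ^ s.2 := by
    unfold cw
    have h0 : 0 < 2 ^ s.2 := by positivity
    have h1 := Nat.div_add_mod (s.1 * 2 ^ l + 2 ^ s.2 - 1) (2 ^ s.2)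
    have h2 := Nat.mod_lt (s.1 * 2 ^ l + 2 ^ s.2 - 1) h0
    rw [mul_comm ((s.1 * 2 ^ l + 2 ^ s.2 - 1) / 2 ^ s.2)]
    omega
  exact_mod_cast h

theorem cw_le (s : ℕ × ℕ) (l : ℕ) : (cw s l : ℝ) / 2 ^ l ≤ (s.1 : ℝ) / 2 ^ s.2 + (1/2) ^ l := by
  have h : cw s l * 2 ^ s.2 ≤ s.1 * 2 ^ l + 2 ^ s.2 := by
    unfold cw
    exact (Nat.div_mul_le_self (s.1 * 2 ^ l + 2 ^ s.2 - 1) (2 ^ s.2)).trans (Nat.sub_le _ _)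
  have h' : (cw s l : ℝ) * 2 ^ s.2 ≤ s.1 * 2 ^ l + 2 ^ s.2 := by exact_mod_cast h
  rw [one_div, inv_pow, div_add' _ _ _ (by positivity), div_le_div_iff₀ (by positivity) (by positivity)]
  have e : ((s.1:ℝ) + (2 ^ l)⁻¹ * 2 ^ s.2) * 2 ^ l = s.1 * 2 ^ l + 2 ^ s.2 := by
    field_simp
  rw [e]; exact h'

theorem wl_none : wl none = 0 := rfl
theorem wl_some (l : ℕ) : wl (some l) = (1/2) ^ l := rfl

noncomputable def kcx (len : ℕ → Option ℕ) (r : ℕ) : ℝ := (kcst len r).1 / 2 ^ (kcst len r).2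

theorem kcx_some {len : ℕ → Option ℕ} {r l : ℕ} (h : len r = some l) :
    kcx len (r+1) = cw (kcst len r) l / 2 ^ l + (1/2) ^ l := by
  simp only [kcx, kcst, h]
  push_cast
  rw [add_div]; simp

theorem kcx_none {len : ℕ → Option ℕ} {r : ℕ} (h : len r = none) :
    kcx len (r+1) = kcx len r := by
  simp only [kcx, kcst, h]

theorem kcx_mono (len : ℕ → Option ℕ) : Monotone (kcx len) := by
  refine monotone_nat_of_le_succ (fun r => ?_)
  rcases h : len r with _ | l
  · rw [kcx_none h]
  · rw [kcx_some h]
    have := cw_ge (kcst len r) l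
    have h2 : (0:ℝ) ≤ (1/2) ^ l := by positivity
    unfold kcx; linarith

theorem kcx_bound (len : ℕ → Option ℕ) (N : ℕ) :
    kcx len N ≤ 2 * ∑ r ∈ Finset.range N, wl (len r) := by
  induction N with
  | zero => simp [kcx, kcst]
  | succ r ih =>
    rw [Finset.sum_range_succ]
    rcases h : len r with _ | l
    · rw [kcx_none h, wl_none]; linarith
    · rw [kcx_some h, wl_some]
      have := cw_le (kcst len r) l
      rw [kcx] at ih
      linarith

theorem computable_cw : Computable₂ cw := by
  have p2 : Primrec (fun x : (ℕ × ℕ) × ℕ => 2 ^ x.1.2) :=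
    primrec_pow.comp (Primrec.const 2) (Primrec.snd.comp Primrec.fst)
  have pl : Primrec (fun x : (ℕ × ℕ) × ℕ => 2 ^ x.2) :=
    primrec_pow.comp (Primrec.const 2) Primrec.snd
  have : Primrec (fun x : (ℕ × ℕ) × ℕ => cw x.1 x.2) :=
    Primrec.nat_div.comp (Primrec.nat_sub.comp (Primrec.nat_add.comp
      (Primrec.nat_mul.comp (Primrec.fst.comp Primrec.fst) pl) p2) (Primrec.const 1)) p2
  exact this.to_comp

theorem computable_kcst {len : ℕ → Option ℕ} (hl : Computable len) : Computable (kcst len) := by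
  have hstep : Computable₂ (fun (_ : ℕ) (x : ℕ × (ℕ × ℕ)) =>
      (Option.casesOn (len x.1) x.2 (fun l => (cw x.2 l + 1, l)) : ℕ × ℕ)) := by
    have h1 : Computable (fun y : ℕ × (ℕ × (ℕ × ℕ)) => len y.2.1) :=
      hl.comp (Computable.fst.comp Computable.snd)
    have h2 : Computable (fun y : ℕ × (ℕ × (ℕ × ℕ)) => y.2.2) :=
      Computable.snd.comp Computable.snd
    have h3 : Computable₂ (fun (y : ℕ × (ℕ × (ℕ × ℕ))) (l : ℕ) => (cw y.2.2 l + 1, l)) :=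
      Computable.pair (Computable.succ.comp (computable_cw.comp (h2.comp Computable.fst) Computable.snd))
        Computable.snd
    exact Computable.option_casesOn h1 h2 h3
  refine (Computable.nat_rec Computable.id (Computable.const (0,0)) hstep).of_eq (fun n => ?_)
  induction n with
  | zero => rfl
  | succ n ih =>
    simp only [id] at ih ⊢
    rw [kcst, ← ih]

theorem computable_bval : Computable bval := by
  have : Primrec bval := by
    have h : Primrec (fun y : List Bool × (ℕ × Bool) => 2 * y.2.1 + y.2.2.toNat) :=
      Primrec.nat_add.comp (Primrec.nat_mul.comp (Primrec.const 2) (Primrec.fst.comp Primrec.snd))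
        ((Primrec.dom_bool Bool.toNat).comp (Primrec.snd.comp Primrec.snd))
    exact Primrec.list_foldl (f := fun p : List Bool => p) (g := fun _ => 0)
      (h := fun _ y => 2 * y.1 + y.2.toNat) Primrec.id (Primrec.const 0) h
  exact this.to_comp

def kctest (len : ℕ → Option ℕ) (p : List Bool) (r : ℕ) : Bool :=
  decide (len r = some p.length) && decide (cw (kcst len r) p.length = bval p)

theorem kctest_lt {len : ℕ → Option ℕ} {p q : List Bool} {r r' : ℕ}
    (hp : kctest len p r = true) (hq : kctest len q r' = true) (h : r < r') :
    ((bval p : ℝ) + 1) / 2 ^ p.length ≤ bval q / 2 ^ q.length := by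
  simp only [kctest, Bool.and_eq_true, decide_eq_true_eq] at hp hq
  have h1 := kcx_mono len (Nat.succ_le_of_lt h)
  have h2 := cw_ge (kcst len r') q.length
  rw [Nat.succ_eq_add_one, kcx_some hp.1, hp.2] at h1
  rw [hq.2] at h2
  have h3 : ((bval p : ℝ) + 1) / 2 ^ p.length = bval p / 2 ^ p.length + (1/2) ^ p.length := by
    rw [add_div]; simp
  rw [h3]
  exact h1.trans h2

theorem kctest_unique {len : ℕ → Option ℕ} {p q : List Bool} {r r' : ℕ}
    (hp : kctest len p r = true) (hq : kctest len q r' = true) (h : p <+: q) : r = r' := by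
  obtain ⟨s, rfl⟩ := h
  have hb := bval_append p s
  have hb1 : (bval p : ℝ) * 2 ^ s.length ≤ bval (p ++ s) := by exact_mod_cast hb.1
  have hb2 : (bval (p ++ s) : ℝ) < (bval p + 1) * 2 ^ s.length := by exact_mod_cast hb.2
  rcases lt_trichotomy r r' with h | h | h
  · have := kctest_lt hp hq h
    rw [div_le_div_iff₀ (by positivity) (by positivity), List.length_append, pow_add] at this
    have h0 : (0:ℝ) < 2 ^ p.length := by positivity
    nlinarith
  · exact h
  · have := kctest_lt hq hp h
    rw [div_le_div_iff₀ (by positivity) (by positivity), List.length_append, pow_add] at this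
    have h0 : (0:ℝ) < 2 ^ p.length := by positivity
    nlinarith

theorem kc_lemma (len : ℕ → Option ℕ) (out : ℕ → List Bool) (hl : Computable len)
    (ho : Computable out) (hs : ∀ N, ∑ r ∈ Finset.range N, wl (len r) ≤ 1/2) :
    ∃ M, IsPrefixFreeMachine M ∧
      ∀ r l, len r = some l → ∃ p : List Bool, p.length = l ∧ M p = Part.some (out r) := by
  have htest : Computable₂ (kctest len) := by
    have l1 : Computable (fun x : List Bool × ℕ => x.1.length) :=
      Computable.list_length.comp Computable.fst
    have h1 : Computable (fun x : List Bool × ℕ => decide (len x.2 = some x.1.length)) :=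
      (Primrec.eq.decide.to_comp).comp (hl.comp Computable.snd) (Computable.option_some.comp l1)
    have h2 : Computable (fun x : List Bool × ℕ => decide (cw (kcst len x.2) x.1.length = bval x.1)) :=
      (Primrec.eq.decide.to_comp).comp
        (computable_cw.comp ((computable_kcst hl).comp Computable.snd) l1)
        (computable_bval.comp Computable.fst)
    exact (Primrec.and.to_comp).comp h1 h2
  have hf : Computable₂ (fun (p : List Bool) (r : ℕ) => bif kctest len p r then some (out r) else none) :=
    Computable.cond htest (Computable.option_some.comp (ho.comp Computable.snd)) (Computable.const none)
  have hM := Partrec.rfindOpt hf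
  have hspec : ∀ p y, y ∈ Nat.rfindOpt (fun r => bif kctest len p r then some (out r) else none) →
      ∃ r, kctest len p r = true ∧ y = out r := by
    intro p y hy
    obtain ⟨r, hr⟩ := Nat.rfindOpt_spec hy
    cases ht : kctest len p r
    · simp [ht] at hr
    · exact ⟨r, ht, by simpa [ht] using hr.symm⟩
  refine ⟨_, ⟨hM, ?_⟩, ?_⟩
  · intro p q hp hq hpq
    obtain ⟨y, hy⟩ := Part.dom_iff_mem.1 hp
    obtain ⟨z, hz⟩ := Part.dom_iff_mem.1 hq
    obtain ⟨r, hr, _⟩ := hspec p y hy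
    obtain ⟨r', hr', _⟩ := hspec q z hz
    have := kctest_unique hr hr' hpq
    subst this
    simp only [kctest, Bool.and_eq_true, decide_eq_true_eq] at hr hr'
    have := hr.1.symm.trans hr'.1
    exact hpq.eq_of_length (by simpa using this)
  · intro r l hrl
    have hlt : cw (kcst len r) l < 2 ^ l := by
      have h1 := (kcx_bound len (r+1)).trans (mul_le_mul_of_nonneg_left (hs (r+1)) (by norm_num))
      rw [kcx_some hrl] at h1
      have h2 : ((cw (kcst len r) l : ℝ) + 1) / 2 ^ l ≤ 1 := by
        rw [add_div]; simpa using h1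
      rw [div_le_one (by positivity)] at h2
      have : cw (kcst len r) l + 1 ≤ 2 ^ l := by exact_mod_cast h2
      omega
    obtain ⟨p, hp, hv⟩ := exists_bval l _ hlt
    have ht : kctest len p r = true := by
      simp [kctest, hp, hv, hrl]
    refine ⟨p, hp, ?_⟩
    have hdom : (Nat.rfindOpt (fun r => bif kctest len p r then some (out r) else none)).Dom :=
      Nat.rfindOpt_dom.2 ⟨r, out r, by simp [ht]⟩
    obtain ⟨y, hy⟩ := Part.dom_iff_mem.1 hdom
    obtain ⟨r', hr', rfl⟩ := hspec p y hy
    have := kctest_unique ht hr' List.prefix_rfl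
    subst this
    exact Part.eq_some_iff.2 hy

/-- Requests of total weight at most `1/2` are met by an optimal machine, up to a constant. -/
theorem kc_optimal {U : List Bool →. List Bool} (hU : IsOptimalMachine U)
    (len : ℕ → Option ℕ) (out : ℕ → List Bool) (hl : Computable len)
    (ho : Computable out) (hs : ∀ N, ∑ r ∈ Finset.range N, wl (len r) ≤ 1/2) :
    ∃ d : ℕ, ∀ r l, len r = some l → ∃ q : List Bool, q.length ≤ l + d ∧ out r ∈ U q := by
  obtain ⟨M, hM, h⟩ := kc_lemma len out hl ho hs
  obtain ⟨d, hd⟩ := hU.2 M hM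
  refine ⟨d, fun r l hr => ?_⟩
  obtain ⟨p, hp, hMp⟩ := h r l hr
  obtain ⟨q, hq, hq'⟩ := hd p (by rw [hMp]; trivial)
  exact ⟨q, by omega, by rw [hq', hMp]; simp⟩

open Nat.Partrec Encodable in
theorem exists_enum {U : List Bool →. List Bool} (hU : Partrec U) :
    ∃ e : ℕ → Option (List Bool × List Bool), Computable e ∧
      (∀ i p y, e i = some (p, y) → y ∈ U p) ∧
      (∀ p y, y ∈ U p → ∃ i, e i = some (p, y)) ∧
      (∀ i j p y y', e i = some (p, y) → e j = some (p, y') → i = j) := by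
  obtain ⟨c, hc⟩ := Code.exists_code.1 hU
  have hev : ∀ p m, m ∈ c.eval (encode p) ↔ ∃ y ∈ U p, encode y = m := by
    intro p m
    rw [hc]; simp
  let g : ℕ → ℕ → List Bool → Option (List Bool × List Bool) := fun k n p =>
    bif (Code.evaln k c n).isSome then Option.none else
      (Code.evaln (k+1) c n).bind fun m => (decode (α := List Bool) m).map fun y => (p, y)
  let e : ℕ → Option (List Bool × List Bool) := fun i =>
    (decode₂ (List Bool) i.unpair.2).bind fun p => g i.unpair.1 i.unpair.2 p
  have he : ∀ i p y, e i = some (p, y) ↔ (encode p = i.unpair.2 ∧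
      Code.evaln i.unpair.1 c i.unpair.2 = Option.none ∧
      ∃ m, Code.evaln (i.unpair.1 + 1) c i.unpair.2 = some m ∧ decode (α := List Bool) m = some y) := by
    intro i p y
    simp only [e, g, Option.bind_eq_some_iff, decode₂_eq_some]
    constructor
    · rintro ⟨p', hp', h⟩
      rcases hv : Code.evaln i.unpair.1 c i.unpair.2 with _ | v
      · rw [hv] at h
        simp only [Option.isSome_none, cond_false, Option.bind_eq_some_iff, Option.map_eq_some_iff,
          Prod.mk.injEq] at h
        obtain ⟨m, hm, y', hy', rfl, rfl⟩ := h
        exact ⟨hp', rfl, m, hm, hy'⟩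
      · rw [hv] at h; simp at h
    · rintro ⟨h1, h2, m, hm, hy⟩
      refine ⟨p, h1, ?_⟩
      simp [h2, hm, hy]
  have hev1 : Primrec (fun i : ℕ => Code.evaln i.unpair.1 c i.unpair.2) :=
    Code.primrec_evaln.comp (((Primrec.fst.comp Primrec.unpair).pair (Primrec.const c)).pair
      (Primrec.snd.comp Primrec.unpair))
  have hev2 : Primrec (fun i : ℕ => Code.evaln (i.unpair.1 + 1) c i.unpair.2) :=
    Code.primrec_evaln.comp (((Primrec.succ.comp (Primrec.fst.comp Primrec.unpair)).pair (Primrec.const c)).pair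
      (Primrec.snd.comp Primrec.unpair))
  refine ⟨e, ?_, ?_, ?_, ?_⟩
  · have : Primrec e := by
      refine Primrec.option_bind (Primrec.decode₂.comp (Primrec.snd.comp Primrec.unpair)) ?_
      have h1 : Primrec (fun x : ℕ × List Bool => (Code.evaln x.1.unpair.1 c x.1.unpair.2).isSome) :=
        Primrec.option_isSome.comp (hev1.comp Primrec.fst)
      have h2 : Primrec (fun x : ℕ × List Bool => 
         (Code.evaln (x.1.unpair.1+1) c x.1.unpair.2).bind fun m => (decode (α := List Bool) m).map fun y => (x.2, y)) := by
        refine Primrec.option_bind (hev2.comp Primrec.fst) ?_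
        refine Primrec.option_map (Primrec.decode.comp Primrec.snd) ?_
        exact (Primrec.snd.comp (Primrec.fst.comp Primrec.fst)).pair Primrec.snd
      exact Primrec.cond h1 (Primrec.const Option.none) h2
    exact this.to_comp
  · intro i p y h
    obtain ⟨h1, _, m, hm, hy⟩ := (he i p y).1 h
    rw [← h1] at hm
    obtain ⟨y', hy', rfl⟩ := (hev p m).1 (Code.evaln_sound hm)
    rw [encodek] at hy
    cases hy; exact hy'
  · intro p y h
    classical
    have h1 := (hev p (encode y)).2 ⟨y, h, rfl⟩
    have h2 : ∃ k, encode y ∈ Code.evaln k c (encode p) := Code.evaln_complete.1 h1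
    have hs := Nat.find_spec h2
    have hm := fun k hk => Nat.find_min h2 (m := k) hk
    set k := Nat.find h2
    obtain _ | k := k
    · simp [Code.evaln] at hs
    refine ⟨Nat.pair k (encode p), (he _ _ _).2 ?_⟩
    rw [Nat.unpair_pair]
    refine ⟨rfl, ?_, encode y, hs, encodek y⟩
    rcases hv : Code.evaln k c (encode p) with _ | v
    · rfl
    · exfalso
      have h4 := Code.evaln_mono (Nat.le_succ k) hv
      have h5 : v = encode y := by
        have := h4.symm.trans hs
        simpa using this
      exact hm k (by omega) (by rw [hv, h5]; rfl)
  · intro i j p y y' hi hj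
    obtain ⟨h1, h2, m, hm, hy⟩ := (he i p y).1 hi
    obtain ⟨h1', h2', m', hm', hy'⟩ := (he j p y').1 hj
    have e2 : i.unpair.2 = j.unpair.2 := h1.symm.trans h1'
    have e1 : i.unpair.1 = j.unpair.1 := by
      rcases lt_trichotomy i.unpair.1 j.unpair.1 with h | h | h
      · have := Code.evaln_mono (Nat.succ_le_of_lt h) hm
        rw [e2, h2'] at this; simp at this
      · exact h
      · have := Code.evaln_mono (Nat.succ_le_of_lt h) hm'
        rw [← e2, h2] at this; simp at this
    rw [← Nat.pair_unpair i, ← Nat.pair_unpair j, e1, e2]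

theorem kraft_finite (S : Finset (List Bool))
    (hS : ∀ p ∈ S, ∀ q ∈ S, p <+: q → p = q) :
    ∑ p ∈ S, ((1:ℝ)/2) ^ p.length ≤ 1 := by
  classical
  obtain ⟨L, hL⟩ : ∃ L, ∀ p ∈ S, p.length ≤ L := by
    refine ⟨S.sup List.length, fun p hp => Finset.le_sup (f := List.length) hp⟩
  let E : List Bool → Finset (List Bool) := fun p =>
    (Finset.univ : Finset (List.Vector Bool (L - p.length))).image (fun s => p ++ s.1)
  have hc : ∀ p, (E p).card = 2 ^ (L - p.length) := by
    intro p
    rw [Finset.card_image_of_injective]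
    · rw [Finset.card_univ, card_vector]; simp
    · intro s t h
      exact Subtype.ext (List.append_cancel_left h)
  have hd : ∀ p ∈ S, ∀ q ∈ S, p ≠ q → Disjoint (E p) (E q) := by
    intro p hp q hq hne
    rw [Finset.disjoint_left]
    intro x hx hx'
    simp only [E, Finset.mem_image, Finset.mem_univ, true_and] at hx hx'
    obtain ⟨s, rfl⟩ := hx
    obtain ⟨t, ht⟩ := hx'
    have h1 : p <+: p ++ s.1 := List.prefix_append _ _
    have h2 : q <+: p ++ s.1 := ht ▸ List.prefix_append _ _
    rcases le_total p.length q.length with h | h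
    · exact hne (hS p hp q hq (List.prefix_of_prefix_length_le h1 h2 h))
    · exact hne (hS q hq p hp (List.prefix_of_prefix_length_le h2 h1 h)).symm
  have hsub : S.biUnion E ⊆ (Finset.univ : Finset (List.Vector Bool L)).image (fun s => s.1) := by
    intro x hx
    simp only [E, Finset.mem_biUnion, Finset.mem_image, Finset.mem_univ, true_and] at hx ⊢
    obtain ⟨p, hp, s, rfl⟩ := hx
    refine ⟨⟨p ++ s.1, ?_⟩, rfl⟩
    have := hL p hp
    rw [List.length_append, s.2]; omega
  have h1 := Finset.card_le_card hsub
  replace h1 := h1.trans Finset.card_image_le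
  rw [Finset.card_biUnion hd, Finset.card_univ, card_vector] at h1
  simp only [hc, Fintype.card_bool] at h1
  have h2 : ∑ p ∈ S, (2:ℝ) ^ (L - p.length) ≤ 2 ^ L := by exact_mod_cast h1
  have h3 : ∀ p ∈ S, ((1:ℝ)/2) ^ p.length = (2:ℝ) ^ (L - p.length) / 2 ^ L := by
    intro p hp
    rw [pow_sub₀ _ two_ne_zero (hL p hp)]
    field_simp
    rw [← mul_pow]; norm_num
  rw [Finset.sum_congr rfl h3, ← Finset.sum_div, div_le_one (by positivity)]
  exact h2

noncomputable def ww (θ : ℝ) (o : Option ℕ) : ℝ := o.elim 0 (fun l => (2:ℝ) ^ (-(θ * l)))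

theorem ww_none (θ : ℝ) : ww θ none = 0 := rfl
theorem ww_some (θ : ℝ) (l : ℕ) : ww θ (some l) = (2:ℝ) ^ (-(θ * l)) := rfl
theorem ww_nonneg (θ : ℝ) (o : Option ℕ) : 0 ≤ ww θ o := by
  cases o
  · exact le_rfl
  · rw [ww_some]; positivity
theorem ww_le_wl {θ : ℝ} (h : 1 ≤ θ) (o : Option ℕ) : ww θ o ≤ wl o := by
  cases o with
  | none => exact le_rfl
  | some l =>
    rw [ww_some, wl_some, one_div, inv_pow, ← Real.rpow_natCast, ← Real.rpow_neg (by norm_num)]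
    apply Real.rpow_le_rpow_of_exponent_le (by norm_num)
    nlinarith [Nat.cast_nonneg (α := ℝ) l]

theorem exists_enum2 {U : List Bool →. List Bool} (hU : IsPrefixFreeMachine U) :
    ∃ (L : ℕ → Option ℕ) (o : ℕ → List Bool), Computable L ∧ Computable o ∧
      (∀ M, ∑ i ∈ Finset.range M, wl (L i) ≤ 1) ∧
      (∀ T : ℝ, 0 < T → T < 1 → HasSum (fun i => ww (1/T) (L i)) (ZT U T)) ∧
      (∀ m q, o m ∈ U q → ∃ i, m ≤ i ∧ L i = some q.length) := by
  classical
  obtain ⟨e, hce, h1, h2, h3⟩ := exists_enum hU.1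
  let L : ℕ → Option ℕ := fun i => (e i).map (fun x => x.1.length)
  let yl : ℕ → ℕ := fun i => Option.casesOn (e i) 0 (fun x => x.2.length)
  let S : ℕ → ℕ := fun m => Nat.rec 1 (fun i s => s + yl i) m
  have hkraft : ∀ M, ∑ i ∈ Finset.range M, wl (L i) ≤ 1 := by
    intro M
    let I := (Finset.range M).filter (fun i => (e i).isSome)
    let P : ℕ → List Bool := fun i => ((e i).map Prod.fst).getD []
    have hP : ∀ i ∈ I, ∃ y, e i = some (P i, y) := by
      intro i hi
      obtain ⟨x, hx⟩ := Option.isSome_iff_exists.1 (Finset.mem_filter.1 hi).2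
      exact ⟨x.2, by simp [P, hx]⟩
    have hinj : Set.InjOn P I := by
      intro i hi j hj hij
      obtain ⟨y, hy⟩ := hP i hi
      obtain ⟨y', hy'⟩ := hP j hj
      rw [← hij] at hy'
      exact h3 _ _ _ _ _ hy hy'
    have hk := kraft_finite (I.image P) (by
      intro p hp q hq
      obtain ⟨i, hi, rfl⟩ := Finset.mem_image.1 hp
      obtain ⟨j, hj, rfl⟩ := Finset.mem_image.1 hq
      obtain ⟨y, hy⟩ := hP i hi
      obtain ⟨y', hy'⟩ := hP j hj
      exact hU.2 _ _ (Part.dom_iff_mem.2 ⟨_, h1 _ _ _ hy⟩) (Part.dom_iff_mem.2 ⟨_, h1 _ _ _ hy'⟩))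
    rw [Finset.sum_image hinj] at hk
    refine le_trans (le_of_eq ?_) hk
    rw [Finset.sum_filter]
    refine Finset.sum_congr rfl fun i _ => ?_
    rcases hx : e i with _ | x
    · simp [L, hx, wl_none]
    · simp [L, P, hx, wl_some]
  refine ⟨L, fun m => List.replicate (S m) true, ?_, ?_, hkraft, ?_, ?_⟩
  · exact Computable.option_map hce
      ((Computable.list_length.comp (Computable.fst.comp Computable.snd)))
  · have hyl : Computable yl := Computable.option_casesOn hce (Computable.const 0)
      (Computable.list_length.comp (Computable.snd.comp Computable.snd))
    have hst : Computable₂ (fun (_ : ℕ) (x : ℕ × ℕ) => x.2 + yl x.1) :=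
      (Primrec.nat_add.to_comp).comp (Computable.snd.comp Computable.snd)
        (hyl.comp (Computable.fst.comp Computable.snd))
    have hS : Computable S := Computable.nat_rec Computable.id (Computable.const 1) hst
    have hr : Computable (fun n : ℕ => List.replicate n true) := by
      have : Computable (fun n : ℕ => (List.range n).map (fun _ => true)) :=
        (Primrec.list_map Primrec.list_range (Primrec.const true).to₂).to_comp
      refine this.of_eq fun n => ?_
      simp
    exact hr.comp hS
  · intro T hT0 hT1
    have hθ : 1 ≤ 1 / T := by rw [le_div_iff₀ hT0]; linarith
    have hsum : Summable (fun i => ww (1/T) (L i)) := by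
      refine summable_of_sum_range_le (c := 1) (fun i => ww_nonneg _ _) fun M => ?_
      exact (Finset.sum_le_sum fun i _ => ww_le_wl hθ (L i)).trans (hkraft M)
    choose φ hφ using fun p : {p : List Bool // (U p).Dom} => h2 p.1 ((U p.1).get p.2) (Part.get_mem _)
    have hinj : Function.Injective φ := by
      intro p q hpq
      have := hφ p
      rw [hpq, hφ q] at this
      simp only [Option.some.injEq, Prod.mk.injEq] at this
      exact Subtype.ext this.1.symm
    have : ZT U T = ∑' i, ww (1/T) (L i) := by
      rw [← hinj.tsum_eq]
      · unfold ZT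
        refine tsum_congr fun p => ?_
        simp only [L, hφ, Option.map_some, ww_some]
        congr 1; ring
      · intro i hi
        rcases hx : e i with _ | ⟨p, y⟩
        · simp [L, hx, ww_none] at hi
        · have hd : (U p).Dom := Part.dom_iff_mem.2 ⟨_, h1 _ _ _ hx⟩
          exact ⟨⟨p, hd⟩, h3 _ _ _ _ _ (hφ ⟨p, hd⟩) hx⟩
    rw [this]; exact hsum.hasSum
  · intro m q hq
    obtain ⟨i, hi⟩ := h2 _ _ hq
    refine ⟨i, ?_, by simp [L, hi]⟩
    by_contra hlt
    push Not at hlt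
    have hS : ∀ k, i < k → yl i < S k := by
      intro k hk
      induction k with
      | zero => omega
      | succ k ih =>
        have hsk : S (k+1) = S k + yl k := rfl
        rcases Nat.lt_succ_iff_lt_or_eq.1 hk with h | h
        · have := ih h; omega
        · subst h
          have : ∀ j, 1 ≤ S j := by
            intro j
            induction j with
            | zero => exact le_rfl
            | succ j ih => have : S (j+1) = S j + yl j := rfl
                           omega
          have := this i; omega
    have h4 := hS m hlt
    have : yl i = S m := by simp [yl, hi]
    omega

theorem theta_approx {T : ℝ} (h0 : 0 < T) (h1 : T < 1) (hT : ComputableReal T) :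
    ∃ u : ℕ → ℕ, Computable u ∧ ∀ N, |1 / T * 2 ^ N - u N| ≤ 2 := by
  obtain ⟨f, hf, hfT⟩ := hT
  obtain ⟨hn, hd⟩ := computable_rat_num_den hf
  obtain ⟨K, hK⟩ := exists_pow_lt_of_lt_one (show 0 < T ^ 2 / 2 by positivity) (show (1/2:ℝ) < 1 by norm_num)
  refine ⟨fun N => 2 ^ N * (f (N + K)).den / (f (N + K)).num.natAbs, ?_, ?_⟩
  · have hadd : Computable (fun N : ℕ => N + K) := (Primrec.nat_add.comp Primrec.id (Primrec.const K)).to_comp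
    have hp : Computable (fun N : ℕ => 2 ^ N) := (primrec_pow.comp (Primrec.const 2) Primrec.id).to_comp
    exact Primrec.nat_div.to_comp.comp (Primrec.nat_mul.to_comp.comp hp (hd.comp hadd)) (hn.comp hadd)
  · intro N
    have h2 := hfT (N + K)
    set t := f (N + K) with ht
    have hz : (2:ℝ) ^ (-((N + K : ℕ) : ℤ)) = (1/2) ^ N * (1/2) ^ K := by
      rw [zpow_neg, zpow_natCast, ← pow_add, one_div, inv_pow]
    rw [hz] at h2
    have hN1 : ((1:ℝ)/2) ^ N ≤ 1 := pow_le_one₀ (by norm_num) (by norm_num)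
    have hN0 : (0:ℝ) < (1/2) ^ N := by positivity
    have hK0 : (0:ℝ) < (1/2) ^ K := by positivity
    have h3 : |T - t| < (1/2) ^ N * (T ^ 2 / 2) := h2.trans (by gcongr)
    have h4 : T / 2 < t := by
      have := (abs_lt.1 h3).2
      nlinarith
    have htp : (0:ℝ) < t := by linarith
    have hnum : 0 < t.num := by
      rw [Rat.num_pos]; exact_mod_cast htp
    have e1 : |1 / T * 2 ^ N - 2 ^ N / t| ≤ 1 := by
      have : 1 / T * 2 ^ N - 2 ^ N / (t:ℝ) = - (2 ^ N * (T - t) / (T * t)) := by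
        field_simp
        ring
      rw [this, abs_neg, abs_div, abs_mul, abs_of_pos (show (0:ℝ) < 2 ^ N by positivity),
        abs_of_pos (show 0 < T * t by positivity), div_le_one (by positivity)]
      have : (2:ℝ) ^ N * |T - t| ≤ 2 ^ N * ((1/2) ^ N * (T ^ 2 / 2)) := by gcongr
      have e : (2:ℝ) ^ N * ((1/2) ^ N * (T ^ 2 / 2)) = T ^ 2 / 2 := by
        rw [← mul_assoc, ← mul_pow]; norm_num
      nlinarith
    have e2 : (2:ℝ) ^ N / t = ((2 ^ N * t.den : ℕ) : ℝ) / (t.num.natAbs : ℕ) := by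
      have h5 : (t : ℝ) = (t.num.natAbs : ℝ) / t.den := by
        have h6 : ((t.num.natAbs : ℕ) : ℝ) = (t.num : ℝ) := by
          have : ((t.num.natAbs : ℕ) : ℤ) = t.num := by omega
          rw [← Int.cast_natCast (R := ℝ), this]
        rw [h6]; exact_mod_cast (Rat.num_div_den t).symm
      rw [h5]; push_cast; field_simp
    have e3 : |((2 ^ N * t.den : ℕ) : ℝ) / (t.num.natAbs : ℕ) - ((2 ^ N * t.den / t.num.natAbs : ℕ) : ℝ)| ≤ 1 := by
      rw [← Nat.floor_div_eq_div (K := ℝ)]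
      have hnn : (0:ℝ) ≤ ((2 ^ N * t.den : ℕ) : ℝ) / (t.num.natAbs : ℕ) := by positivity
      have := Nat.floor_le hnn
      have := Nat.lt_floor_add_one (((2 ^ N * t.den : ℕ) : ℝ) / (t.num.natAbs : ℕ))
      rw [abs_le]; constructor <;> linarith
    rw [e2] at e1
    have := abs_le.1 e1
    have := abs_le.1 e3
    rw [abs_le]; constructor <;> linarith

theorem two_rpow_lip {x y : ℝ} (hx : 0 ≤ x) (hy : 0 ≤ y) :
    |(2:ℝ) ^ (-x) - 2 ^ (-y)| ≤ |x - y| := by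
  wlog h : x ≤ y generalizing x y
  · rw [abs_sub_comm, abs_sub_comm x]; exact this hy hx (le_of_not_ge h)
  have h1 : (2:ℝ) ^ (-y) = 2 ^ (-x) * 2 ^ (-(y - x)) := by
    rw [← Real.rpow_add (by norm_num)]; congr 1; ring
  have h2 : (2:ℝ) ^ (-x) ≤ 1 := Real.rpow_le_one_of_one_le_of_nonpos (by norm_num) (by linarith)
  have h2' : (0:ℝ) < (2:ℝ) ^ (-x) := by positivity
  have h3 : (2:ℝ) ^ (-(y - x)) ≤ 1 := Real.rpow_le_one_of_one_le_of_nonpos (by norm_num) (by linarith)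
  have h4 : 1 - (2:ℝ) ^ (-(y - x)) ≤ y - x := by
    rw [Real.rpow_def_of_pos (by norm_num)]
    have := Real.add_one_le_exp (Real.log 2 * -(y - x))
    have h5 : Real.log 2 ≤ 1 := by linarith [Real.log_two_lt_d9]
    nlinarith
  rw [abs_of_nonneg (by rw [h1]; nlinarith), abs_of_nonpos (by linarith), h1]
  nlinarith

def gfind (a N j : ℕ) : ℕ := Nat.findGreatest (fun g => g ^ (2 ^ N) * 2 ^ a ≤ 2 ^ (j * 2 ^ N)) (2 ^ j)

theorem gfind_approx (a N j : ℕ) : |(gfind a N j : ℝ) - 2 ^ j * 2 ^ (-((a:ℝ) / 2 ^ N))| ≤ 1 := by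
  set y : ℝ := 2 ^ j * 2 ^ (-((a:ℝ) / 2 ^ N)) with hy
  have hy0 : 0 < y := by positivity
  have hyj : y ≤ 2 ^ j := by
    have : (2:ℝ) ^ (-((a:ℝ) / 2 ^ N)) ≤ 1 :=
      Real.rpow_le_one_of_one_le_of_nonpos (by norm_num) (neg_nonpos.2 (by positivity))
    have h0 : (0:ℝ) < 2 ^ j := by positivity
    nlinarith
  have hyN : y ^ (2 ^ N) * 2 ^ a = 2 ^ (j * 2 ^ N) := by
    rw [hy, mul_pow, ← pow_mul, ← Real.rpow_natCast (2 ^ (-((a:ℝ) / 2 ^ N))), ← Real.rpow_mul (by norm_num),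
      mul_assoc, ← Real.rpow_natCast 2 a, ← Real.rpow_add (by norm_num)]
    have : -((a:ℝ) / 2 ^ N) * ((2 ^ N : ℕ) : ℝ) + a = 0 := by
      push_cast; field_simp; ring
    rw [this]; simp
  have key : ∀ g : ℕ, g ^ (2 ^ N) * 2 ^ a ≤ 2 ^ (j * 2 ^ N) ↔ (g : ℝ) ≤ y := by
    intro g
    have : (g ^ (2 ^ N) * 2 ^ a ≤ 2 ^ (j * 2 ^ N)) ↔ ((g:ℝ) ^ (2 ^ N) * 2 ^ a ≤ 2 ^ (j * 2 ^ N)) := by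
      exact_mod_cast Iff.rfl
    rw [this, ← hyN, mul_le_mul_iff_left₀ (by positivity), pow_le_pow_iff_left₀ (by positivity) hy0.le (by positivity)]
  have h1 : (gfind a N j : ℝ) ≤ y := by
    rw [← key]
    exact Nat.findGreatest_spec (P := fun g => g ^ (2 ^ N) * 2 ^ a ≤ 2 ^ (j * 2 ^ N)) (m := 0) (Nat.zero_le _)
      ((key 0).2 (by simpa using hy0.le))
  have h2 : y < gfind a N j + 1 := by
    by_contra hlt
    push Not at hlt
    have h3 : gfind a N j + 1 ≤ 2 ^ j := by exact_mod_cast hlt.trans hyj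
    have := Nat.le_findGreatest (P := fun g => g ^ (2 ^ N) * 2 ^ a ≤ 2 ^ (j * 2 ^ N)) h3
      ((key _).2 (by exact_mod_cast hlt))
    unfold gfind at this; omega
  rw [abs_le]; constructor <;> linarith

theorem primrec_gfind : Primrec (fun x : ℕ × ℕ × ℕ => gfind x.1 x.2.1 x.2.2) := by
  have h2 : Primrec (fun n : ℕ => 2 ^ n) := primrec_pow.comp (Primrec.const 2) Primrec.id
  unfold gfind
  refine Primrec.nat_findGreatest (h2.comp (Primrec.snd.comp Primrec.snd)) ?_
  refine PrimrecRel.comp (R := fun a b : ℕ => a ≤ b) Primrec.nat_le ?_ ?_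
  · refine Primrec.nat_mul.comp (primrec_pow.comp Primrec.snd (h2.comp ?_)) (h2.comp ?_)
    · exact Primrec.fst.comp (Primrec.snd.comp Primrec.fst)
    · exact Primrec.fst.comp Primrec.fst
  · refine h2.comp (Primrec.nat_mul.comp ?_ (h2.comp ?_))
    · exact Primrec.snd.comp (Primrec.snd.comp Primrec.fst)
    · exact Primrec.fst.comp (Primrec.snd.comp Primrec.fst)

attribute [irreducible] gfind

theorem exists_G {T : ℝ} (h0 : 0 < T) (h1 : T < 1) (hT : ComputableReal T) :
    (∃ G : ℕ → ℕ → ℕ, Computable₂ G ∧ ∀ l j, |(G l j : ℝ) - 2 ^ j * 2 ^ (-(1 / T * l))| ≤ 3) ∧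
    (∃ ν : ℕ → ℕ, Computable ν ∧ ∀ l : ℕ, |(ν l : ℝ) - 1 / T * l| ≤ 3) := by
  obtain ⟨u, hu, hua⟩ := theta_approx h0 h1 hT
  have hθ : 0 < 1 / T := by positivity
  have hl2 : ∀ l : ℕ, (l : ℝ) ≤ 2 ^ l := fun l => by exact_mod_cast l.lt_two_pow_self.le
  constructor
  · refine ⟨fun l j => gfind (l * u (j + l)) (j + l) j, ?_, ?_⟩
    · have hN : Computable (fun x : ℕ × ℕ => x.2 + x.1) :=
        (Primrec.nat_add.comp Primrec.snd Primrec.fst).to_comp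
      have h3 : Computable (fun x : ℕ × ℕ => (x.1 * u (x.2 + x.1), x.2 + x.1, x.2)) :=
        (Primrec.nat_mul.to_comp.comp Computable.fst (hu.comp hN)).pair (hN.pair Computable.snd)
      have h4 := primrec_gfind.to_comp.comp h3
      exact h4
    · intro l j
      have e1 := gfind_approx (l * u (j + l)) (j + l) j
      have e2 : |((l * u (j + l) : ℕ) : ℝ) / 2 ^ (j + l) - 1 / T * l| ≤ 2 / 2 ^ j := by
        have h3 := hua (j + l)
        have : ((l * u (j + l) : ℕ) : ℝ) / 2 ^ (j + l) - 1 / T * l = - ((1 / T * 2 ^ (j + l) - u (j + l)) * l / 2 ^ (j+l)) := by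
          push_cast; field_simp; ring
        rw [this, abs_neg, abs_div, abs_mul, abs_of_nonneg (Nat.cast_nonneg (α := ℝ) l),
          abs_of_pos (show (0:ℝ) < 2 ^ (j+l) by positivity), div_le_div_iff₀ (by positivity) (by positivity)]
        have h4 := hl2 l
        have h5 : |1 / T * 2 ^ (j + l) - u (j + l)| * l ≤ 2 * 2 ^ l :=
          mul_le_mul h3 h4 (by positivity) (by positivity)
        have h6 : (0:ℝ) < 2 ^ j := by positivity
        rw [show (2:ℝ) * 2 ^ (j + l) = 2 * 2 ^ l * 2 ^ j by rw [pow_add]; ring]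
        exact mul_le_mul_of_nonneg_right h5 h6.le
      have e3 := (two_rpow_lip (show 0 ≤ ((l * u (j + l) : ℕ) : ℝ) / 2 ^ (j + l) by positivity)
        (show 0 ≤ 1 / T * l by positivity)).trans e2
      have hj : (0:ℝ) < 2 ^ j := by positivity
      have e4 : |(2:ℝ) ^ j * 2 ^ (-(((l * u (j + l) : ℕ) : ℝ) / 2 ^ (j + l))) - 2 ^ j * 2 ^ (-(1 / T * l))| ≤ 2 := by
        rw [← mul_sub, abs_mul, abs_of_pos hj]
        calc _ ≤ (2:ℝ) ^ j * (2 / 2 ^ j) := by gcongr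
          _ = 2 := by field_simp
      have := abs_le.1 e1
      have := abs_le.1 e4
      rw [abs_le]; constructor <;> linarith
  · refine ⟨fun l => l * u l / 2 ^ l, ?_, ?_⟩
    · exact Primrec.nat_div.to_comp.comp (Primrec.nat_mul.to_comp.comp Computable.id hu)
        (primrec_pow.comp (Primrec.const 2) Primrec.id).to_comp
    · intro l
      have h3 := hua l
      have e1 : |((l * u l : ℕ) : ℝ) / ((2 ^ l : ℕ) : ℝ) - 1 / T * l| ≤ 2 := by
        have : ((l * u l : ℕ) : ℝ) / ((2 ^ l : ℕ) : ℝ) - 1 / T * l = - ((1 / T * 2 ^ l - u l) * l / 2 ^ l) := by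
          push_cast; field_simp; ring
        rw [this, abs_neg, abs_div, abs_mul, abs_of_nonneg (Nat.cast_nonneg (α := ℝ) l),
          abs_of_pos (show (0:ℝ) < 2 ^ l by positivity), div_le_iff₀ (by positivity)]
        exact mul_le_mul h3 (hl2 l) (by positivity) (by positivity)
      have e2 : |((l * u l : ℕ) : ℝ) / ((2 ^ l : ℕ) : ℝ) - ((l * u l / 2 ^ l : ℕ) : ℝ)| ≤ 1 := by
        rw [← Nat.floor_div_eq_div (K := ℝ)]
        have hnn : (0:ℝ) ≤ ((l * u l : ℕ) : ℝ) / ((2 ^ l : ℕ) : ℝ) := by positivity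
        have := Nat.floor_le hnn
        have := Nat.lt_floor_add_one (((l * u l : ℕ) : ℝ) / ((2 ^ l : ℕ) : ℝ))
        rw [abs_le]; constructor <;> linarith
      have := abs_le.1 e1
      have := abs_le.1 e2
      rw [abs_le]; constructor <;> linarith

def vinc (L : ℕ → Option ℕ) (G : ℕ → ℕ → ℕ) (n m : ℕ) : ℕ :=
  Option.casesOn (L m) 0 (fun l => G l (2 * n + m + 1))

def vseq (L : ℕ → Option ℕ) (G : ℕ → ℕ → ℕ) (n m : ℕ) : ℕ :=
  Nat.rec 6 (fun i s => 2 * s + vinc L G n i) m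

theorem vseq_succ (L : ℕ → Option ℕ) (G : ℕ → ℕ → ℕ) (n m : ℕ) :
    vseq L G n (m+1) = 2 * vseq L G n m + vinc L G n m := rfl

theorem computable_vseq {L : ℕ → Option ℕ} (hL : Computable L) {G : ℕ → ℕ → ℕ} (hG : Computable₂ G) :
    Computable₂ (vseq L G) := by
  have h1 : Computable₂ (fun (x : ℕ × ℕ) (l : ℕ) => G l (2 * x.1 + x.2 + 1)) := by
    have h2 : Computable (fun x : (ℕ × ℕ) × ℕ => 2 * x.1.1 + x.1.2 + 1) :=
      (Primrec.succ.comp (Primrec.nat_add.comp (Primrec.nat_mul.comp (Primrec.const 2)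
        (Primrec.fst.comp Primrec.fst)) (Primrec.snd.comp Primrec.fst))).to_comp
    exact hG.comp Computable.snd h2
  have h3 : Computable (fun x : ℕ × ℕ => vinc L G x.1 x.2) :=
    Computable.option_casesOn (hL.comp Computable.snd) (Computable.const 0) h1
  have h4 : Computable₂ (fun (x : ℕ × ℕ) (y : ℕ × ℕ) => 2 * y.2 + vinc L G x.1 y.1) := by
    have h5 : Computable (fun z : (ℕ × ℕ) × (ℕ × ℕ) => (z.1.1, z.2.1)) :=
      (Computable.fst.comp Computable.fst).pair (Computable.fst.comp Computable.snd)
    have h6 := h3.comp h5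
    have h7 : Computable (fun z : (ℕ × ℕ) × (ℕ × ℕ) => 2 * z.2.2) :=
      (Primrec.nat_mul.comp (Primrec.const 2) (Primrec.snd.comp Primrec.snd)).to_comp
    exact Primrec.nat_add.to_comp.comp h7 h6
  exact Computable.nat_rec Computable.snd (Computable.const 6) h4

theorem exists_A {L : ℕ → Option ℕ} (hL : Computable L) {T : ℝ} (h0 : 0 < T) (h1 : T < 1)
    (hT : ComputableReal T) :
    ∃ A : ℕ → ℕ → ℝ, Computable₂ (fun n m => ⌊A n m⌋₊) ∧
      (∀ n, A n 0 = 6 / 2 ^ n) ∧ (∀ n m, A n m ≤ A n (m+1)) ∧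
      (∀ n m, A n (m+1) - A n m ≤ 2 ^ n * ww (1/T) (L m) + 3 / 2 ^ (n + m + 1)) ∧
      (∀ n m, 2 ^ n * ∑ i ∈ Finset.range m, ww (1/T) (L i) + 3 / 2 ^ n ≤ A n m) ∧
      (∀ n m, A n m ≤ 2 ^ n * ∑ i ∈ Finset.range m, ww (1/T) (L i) + 9 / 2 ^ n) := by
  obtain ⟨⟨G, hG, hGa⟩, -⟩ := exists_G h0 h1 hT
  let A : ℕ → ℕ → ℝ := fun n m => (vseq L G n m : ℝ) / ((2 ^ (n + m) : ℕ) : ℝ)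
  have hA : ∀ n m, A n (m+1) - A n m = vinc L G n m / 2 ^ (n + m + 1) := by
    intro n m
    simp only [A, vseq_succ]
    push_cast
    rw [← add_assoc, pow_succ]
    field_simp
    ring
  have hv : ∀ n m, |(vinc L G n m : ℝ) / 2 ^ (n + m + 1) - 2 ^ n * ww (1/T) (L m)| ≤ 3 / 2 ^ (n + m + 1) := by
    intro n m
    rcases hx : L m with _ | l
    · simp only [vinc, hx, ww_none]; simp; positivity
    · simp only [vinc, hx, ww_some]
      have h2 := hGa l (2 * n + m + 1)
      have e : (G l (2 * n + m + 1) : ℝ) / 2 ^ (n + m + 1) - 2 ^ n * 2 ^ (-(1 / T * (l:ℝ))) =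
          (G l (2 * n + m + 1) - 2 ^ (2 * n + m + 1) * 2 ^ (-(1 / T * (l:ℝ)))) / 2 ^ (n + m + 1) := by
        rw [show 2 * n + m + 1 = n + (n + m + 1) by ring, pow_add 2 n (n + m + 1), sub_div]
        congr 1
        field_simp
      rw [e, abs_div, abs_of_pos (show (0:ℝ) < 2 ^ (n + m + 1) by positivity)]
      gcongr
  have hA0 : ∀ n, A n 0 = 6 / 2 ^ n := by
    intro n; simp [A, vseq]
  have hb : ∀ n m, |A n m - 6 / 2 ^ n - 2 ^ n * ∑ i ∈ Finset.range m, ww (1/T) (L i)| ≤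
      3 / 2 ^ n - 3 / 2 ^ (n + m) := by
    intro n m
    induction m with
    | zero => simp [hA0]
    | succ m ih =>
      rw [Finset.sum_range_succ]
      have e1 := abs_le.1 (hv n m)
      have e2 := hA n m
      have e3 := abs_le.1 ih
      have e4 : (3:ℝ) / 2 ^ (n + m) = 2 * (3 / 2 ^ (n + m + 1)) := by
        rw [pow_succ]; field_simp
      rw [← add_assoc n m 1]
      rw [abs_le]; constructor <;> linarith
  have hpos : ∀ k : ℕ, (0:ℝ) < 3 / 2 ^ k := fun k => by positivity
  have e36 : ∀ n : ℕ, (6:ℝ) / 2 ^ n = 2 * (3 / 2 ^ n) ∧ (9:ℝ) / 2 ^ n = 3 * (3 / 2 ^ n) := by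
    intro n; constructor <;> ring
  refine ⟨A, ?_, hA0, ?_, ?_, ?_, ?_⟩
  · have h2 : Computable₂ (fun n m => vseq L G n m / 2 ^ (n + m)) := by
      have h3 : Computable (fun x : ℕ × ℕ => 2 ^ (x.1 + x.2)) :=
        (primrec_pow.comp (Primrec.const 2) (Primrec.nat_add.comp Primrec.fst Primrec.snd)).to_comp
      exact Primrec.nat_div.to_comp.comp (computable_vseq hL hG) h3
    refine h2.of_eq fun x => ?_
    simp only [A]
    exact (Nat.floor_div_eq_div _ _).symm
  · intro n m
    have : 0 ≤ (vinc L G n m : ℝ) / 2 ^ (n + m + 1) := by positivity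
    linarith [hA n m]
  · intro n m
    linarith [hA n m, (abs_le.1 (hv n m)).2]
  · intro n m
    have := (abs_le.1 (hb n m)).1
    have := (e36 n).1
    linarith [hpos (n + m)]
  · intro n m
    have := (abs_le.1 (hb n m)).2
    have := (e36 n).1
    have := (e36 n).2
    linarith [hpos (n + m)]

theorem partial_add_le {w : ℕ → ℝ} {Z : ℝ} (hw : ∀ i, 0 ≤ w i) (hZ : HasSum w Z) {m i : ℕ} (h : m ≤ i) :
    ∑ j ∈ Finset.range m, w j + w i ≤ Z := by
  have h1 := sum_le_hasSum (insert i (Finset.range m)) (fun j _ => hw j) hZ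
  rw [Finset.sum_insert (by simpa using h)] at h1
  linarith

theorem nat_floor_half (Z : ℝ) (n : ℕ) : ⌊Z * 2 ^ n⌋₊ = ⌊Z * 2 ^ (n+1)⌋₊ / 2 := by
  have := Nat.floor_div_natCast (Z * 2 ^ (n+1)) 2
  rw [← this]; congr 1
  rw [pow_succ]; push_cast; ring

theorem binDigit_nat {Z : ℝ} (hZ : 0 ≤ Z) (n : ℕ) :
    binDigit Z n = decide (⌊Z * 2 ^ (n+1)⌋₊ % 2 = 1) := by
  unfold binDigit
  have : (⌊Z * 2 ^ (n+1)⌋) = ((⌊Z * 2 ^ (n+1)⌋₊ : ℕ) : ℤ) :=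
    (Int.natCast_floor_eq_floor (by positivity)).symm
  rw [this]
  congr 1
  apply propext
  omega

theorem nat_floor_step {Z : ℝ} (hZ : 0 ≤ Z) (n : ℕ) :
    ⌊Z * 2 ^ (n+1)⌋₊ = 2 * ⌊Z * 2 ^ n⌋₊ + (binDigit Z n).toNat := by
  rw [binDigit_nat hZ, nat_floor_half Z n]
  by_cases h : ⌊Z * 2 ^ (n+1)⌋₊ % 2 = 1
  · rw [decide_eq_true h]; simp only [Bool.toNat_true]; omega
  · rw [decide_eq_false h]; simp only [Bool.toNat_false]; omega

theorem floor_zero_run {Z : ℝ} (hZ : 0 ≤ Z) (n k : ℕ) (h : ∀ i, i < k → binDigit Z (n + i) = false) :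
    ⌊Z * 2 ^ (n+k)⌋₊ = 2 ^ k * ⌊Z * 2 ^ n⌋₊ := by
  induction k with
  | zero => simp
  | succ k ih =>
    rw [← add_assoc, nat_floor_step hZ, ih (fun i hi => h i (by omega)), h k (by omega)]
    simp only [Bool.toNat_false]; ring

theorem computable_floor {Z : ℝ} (hZ : 0 ≤ Z) (h : Computable (fun n => binDigit Z n)) :
    Computable (fun n => ⌊Z * 2 ^ n⌋₊) := by
  have ht : Computable Bool.toNat := by
    refine (Computable.cond Computable.id (Computable.const 1) (Computable.const 0)).of_eq fun b => ?_
    cases b <;> rfl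
  have h1 : Computable₂ (fun (_ : ℕ) (x : ℕ × ℕ) => 2 * x.2 + (binDigit Z x.1).toNat) := by
    have h2 : Computable (fun x : ℕ × (ℕ × ℕ) => 2 * x.2.2) :=
      (Primrec.nat_mul.comp (Primrec.const 2) (Primrec.snd.comp Primrec.snd)).to_comp
    have h3 : Computable (fun x : ℕ × (ℕ × ℕ) => (binDigit Z x.2.1).toNat) :=
      ht.comp (h.comp (Computable.fst.comp Computable.snd))
    exact Primrec.nat_add.to_comp.comp h2 h3
  have h2 := Computable.nat_rec Computable.id (Computable.const ⌊Z * 2 ^ 0⌋₊) h1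
  refine h2.of_eq fun n => ?_
  induction n with
  | zero => rfl
  | succ n ih =>
    rw [nat_floor_step hZ, ← ih]; rfl

theorem A_reach {w : ℕ → ℝ} {Z : ℝ} (hZ : HasSum w Z) {A : ℕ → ℕ → ℝ}
    (hlo : ∀ n m, 2 ^ n * ∑ i ∈ Finset.range m, w i + 3 / 2 ^ n ≤ A n m) (n : ℕ) :
    ∃ m, Z * 2 ^ n ≤ A n m := by
  have h1 := hZ.tendsto_sum_nat
  have h2 : Z - 3 / 2 ^ n / 2 ^ n < Z := by
    have : (0:ℝ) < 3 / 2 ^ n / 2 ^ n := by positivity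
    linarith
  obtain ⟨m, hm⟩ := (h1.eventually (lt_mem_nhds h2)).exists
  refine ⟨m, le_trans ?_ (hlo n m)⟩
  have h3 : (0:ℝ) < 2 ^ n := by positivity
  have h4 := mul_lt_mul_of_pos_left hm h3
  have h5 : (2:ℝ) ^ n * (Z - 3 / 2 ^ n / 2 ^ n) = Z * 2 ^ n - 3 / 2 ^ n := by
    field_simp
  linarith

/-- Abstract form of the coding theorem for an enumeration of lengths. -/
def KCA (L : ℕ → Option ℕ) : Prop :=
  ∀ (len : ℕ → Option ℕ) (mm : ℕ → ℕ), Computable len → Computable mm →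
    (∀ N, ∑ r ∈ Finset.range N, wl (len r) ≤ 1/2) →
    ∃ d, ∀ r l, len r = some l → ∃ i l', mm r ≤ i ∧ L i = some l' ∧ l' ≤ l + d

theorem not_computable_core {L : ℕ → Option ℕ} {θ Z : ℝ} (hθ : 0 < θ)
    (hZ : HasSum (fun i => ww θ (L i)) Z) (hK : KCA L)
    {A : ℕ → ℕ → ℝ} (hA : Computable₂ (fun n m => ⌊A n m⌋₊))
    (hlo : ∀ n m, 2 ^ n * ∑ i ∈ Finset.range m, ww θ (L i) + 3 / 2 ^ n ≤ A n m)
    (hhi : ∀ n m, A n m ≤ 2 ^ n * ∑ i ∈ Finset.range m, ww θ (L i) + 9 / 2 ^ n) :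
    ¬ Computable (fun n => binDigit Z n) := by
  intro hc
  have hZ0 : 0 ≤ Z := hZ.nonneg (fun i => ww_nonneg _ _)
  have hF := computable_floor hZ0 hc
  have hex : ∀ n, ∃ m, decide (⌊Z * 2 ^ n⌋₊ ≤ ⌊A n m⌋₊) = true := by
    intro n
    obtain ⟨m, hm⟩ := A_reach hZ hlo n
    exact ⟨m, decide_eq_true (Nat.floor_mono hm)⟩
  have hd : Computable₂ (fun (n m : ℕ) => decide (⌊Z * 2 ^ n⌋₊ ≤ ⌊A n m⌋₊)) := by
    have h1 : Computable (fun x : ℕ × ℕ => decide (x.1 ≤ x.2)) := (Primrec.nat_le.decide).to_comp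
    have h2 : Computable (fun x : ℕ × ℕ => (⌊Z * 2 ^ x.1⌋₊, ⌊A x.1 x.2⌋₊)) :=
      (hF.comp Computable.fst).pair hA
    exact h1.comp h2
  have hm := computable_find hd hex
  have hspec := fun n => of_decide_eq_true (Nat.find_spec (hex n))
  set M : ℕ → ℕ := fun n => Nat.find (hex n) with hM
  have hgap : ∀ n, Z ≤ ∑ i ∈ Finset.range (M n), ww θ (L i) + 10 / 2 ^ n := by
    intro n
    have h1 := Nat.lt_floor_add_one (Z * 2 ^ n)
    have h2 : (⌊Z * 2 ^ n⌋₊ : ℝ) ≤ A n (M n) := by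
      have hpos : 0 ≤ A n (M n) := by
        refine le_trans ?_ (hlo n (M n))
        have : 0 ≤ ∑ i ∈ Finset.range (M n), ww θ (L i) := Finset.sum_nonneg fun i _ => ww_nonneg _ _
        positivity
      refine le_trans ?_ (Nat.floor_le hpos)
      exact Nat.cast_le.2 (hspec n)
    have h3 := hhi n (M n)
    have h4 : (9:ℝ) / 2 ^ n ≤ 9 := div_le_self (by norm_num) (one_le_pow₀ (by norm_num))
    have h5 : (0:ℝ) < 2 ^ n := by positivity
    rw [← mul_le_mul_iff_left₀ h5, add_mul, div_mul_cancel₀ _ h5.ne']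
    linarith
  obtain ⟨d, hdd⟩ := hK (fun r => some (r + 2)) (fun r => M (r ^ 2))
    (Primrec.option_some.comp (Primrec.nat_add.comp Primrec.id (Primrec.const 2))).to_comp
    (hm.comp (primrec_pow.comp Primrec.id (Primrec.const 2)).to_comp) (by
      intro N
      have : ∑ r ∈ Finset.range N, wl (some (r + 2)) ≤ 1/2 - 1/2 * (1/2) ^ N := by
        induction N with
        | zero => simp
        | succ N ih =>
          rw [Finset.sum_range_succ, wl_some]
          rw [pow_succ, pow_add]; linarith
      have h2 : (0:ℝ) < (1/2) ^ N := by positivity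
      linarith)
  obtain ⟨b, hb⟩ := exists_nat_ge θ
  have hall : ∀ r : ℕ, r ^ 2 ≤ 4 + b * (r + 2 + d) := by
    intro r
    obtain ⟨i, l', hi, hl, hle⟩ := hdd r (r+2) rfl
    have h1 := partial_add_le (fun i => ww_nonneg θ (L i)) hZ hi
    have h2 := hgap (r ^ 2)
    rw [hl, ww_some] at h1
    have h3 : (2:ℝ) ^ (-((b * (r + 2 + d) : ℕ) : ℝ)) ≤ 2 ^ (-(θ * l')) := by
      apply Real.rpow_le_rpow_of_exponent_le (by norm_num)
      have h4 : (l' : ℝ) ≤ (r + 2 + d : ℕ) := by exact_mod_cast hle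
      push_cast at h4 ⊢
      have : θ * l' ≤ b * (r + 2 + d) := mul_le_mul hb h4 (by positivity) (by positivity)
      linarith
    rw [Real.rpow_neg (by norm_num), Real.rpow_natCast] at h3
    have h5 : ((2:ℝ) ^ (b * (r + 2 + d)))⁻¹ ≤ 10 / 2 ^ (r ^ 2) := by linarith
    rw [← one_div, div_le_div_iff₀ (by positivity) (by positivity)] at h5
    have h6 : (2:ℝ) ^ (r ^ 2) ≤ 2 ^ (4 + b * (r + 2 + d)) := by
      rw [pow_add]
      have : (0:ℝ) < 2 ^ (b * (r + 2 + d)) := by positivity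
      linarith
    exact (pow_le_pow_iff_right₀ (by norm_num)).1 h6
  have h7 := hall (b + (5 + 2 * b + b * d))
  set s := 5 + 2 * b + b * d with hs
  have h8 : b * (b + s + 2 + d) = b * (b + s) + (2 * b + b * d) := by ring
  have h9 : (b + s) ^ 2 = b * (b + s) + s * (b + s) := by ring
  have h10 : s * 1 ≤ s * (b + s) := Nat.mul_le_mul_left _ (by omega)
  omega

theorem ell_sum {ρ : ℝ} (h0 : 0 < ρ) (h1 : ρ < 1) (l N : ℕ) :
    ∑ k ∈ Finset.range N, (if l ≤ k then 2 * ((1:ℝ)/2) ^ k else 8 * (1/2) ^ l * ρ ^ (l - k)) ≤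
      (4 + 8 / (1 - ρ)) * (1/2) ^ l := by
  have hr : 0 < 1 - ρ := by linarith
  have hA : ∀ N, N ≤ l → ∑ k ∈ Finset.range N, (if l ≤ k then 2 * ((1:ℝ)/2) ^ k else 8 * (1/2) ^ l * ρ ^ (l - k)) ≤
      8 * (1/2) ^ l * (ρ ^ (l - N) / (1 - ρ)) := by
    intro N hN
    induction N with
    | zero => simp; positivity
    | succ N ih =>
      rw [Finset.sum_range_succ, if_neg (by omega)]
      obtain ⟨t, rfl⟩ := Nat.exists_eq_add_of_le hN
      have e1 : N + 1 + t - N = t + 1 := by omega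
      have e2 : N + 1 + t - (N + 1) = t := by omega
      have := ih (by omega)
      rw [e1] at this ⊢
      rw [e2]
      refine (add_le_add_left this _).trans ?_
      rw [← mul_add]
      refine mul_le_mul_of_nonneg_left ?_ (by positivity)
      rw [div_add' _ _ _ hr.ne']
      refine div_le_div_of_nonneg_right ?_ hr.le
      have : 0 < ρ ^ t := by positivity
      rw [pow_succ]
      nlinarith [mul_nonneg this.le (sq_nonneg (1 - ρ))]
  have hB : ∀ t, ∑ k ∈ Finset.range (l + t), (if l ≤ k then 2 * ((1:ℝ)/2) ^ k else 8 * (1/2) ^ l * ρ ^ (l - k)) ≤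
      8 * (1/2) ^ l * (1 / (1 - ρ)) + 4 * (1/2) ^ l - 4 * (1/2) ^ (l + t) := by
    intro t
    induction t with
    | zero => have := hA l le_rfl
              simp only [Nat.sub_self, pow_zero] at this
              simp only [add_zero]; linarith
    | succ t ih =>
      rw [← add_assoc, Finset.sum_range_succ, if_pos (by omega), pow_succ]
      linarith
  have e : (4 + 8 / (1 - ρ)) * (1/2) ^ l = 8 * (1/2) ^ l * (1 / (1 - ρ)) + 4 * (1/2) ^ l := by ring
  rw [e]
  rcases le_total N l with h | h
  · refine (hA N h).trans ?_
    have h2 : ρ ^ (l - N) ≤ 1 := pow_le_one₀ h0.le h1.le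
    have h3 : 8 * ((1:ℝ)/2) ^ l * (ρ ^ (l - N) / (1 - ρ)) ≤ 8 * (1/2) ^ l * (1 / (1 - ρ)) := by gcongr
    have : (0:ℝ) < 4 * (1/2) ^ l := by positivity
    linarith
  · obtain ⟨t, rfl⟩ := Nat.exists_eq_add_of_le h
    have := hB t
    have : (0:ℝ) < 4 * (1/2) ^ (l + t) := by positivity
    linarith

theorem sum_unpair_le {f : ℕ → ℕ → ℝ} (hf : ∀ m l, 0 ≤ f m l) (N : ℕ) :
    ∑ r ∈ Finset.range N, f r.unpair.1 r.unpair.2 ≤ ∑ l ∈ Finset.range N, ∑ m ∈ Finset.range N, f m l := by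
  rw [Finset.sum_comm, ← Finset.sum_product' (Finset.range N) (Finset.range N) f]
  have hinj : Set.InjOn Nat.unpair (Finset.range N : Finset ℕ) := by
    intro a _ b _ h
    rw [← Nat.pair_unpair a, ← Nat.pair_unpair b, h]
  rw [← Finset.sum_image (f := fun x : ℕ × ℕ => f x.1 x.2) hinj]
  refine Finset.sum_le_sum_of_subset_of_nonneg ?_ (fun x _ _ => hf _ _)
  intro x hx
  obtain ⟨r, hr, rfl⟩ := Finset.mem_image.1 hx
  have h1 := Nat.unpair_left_le r
  have h2 := Nat.unpair_right_le r
  simp only [Finset.mem_product, Finset.mem_range] at hr ⊢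
  omega

noncomputable def cc (θ : ℝ) (ν : ℕ → ℕ) (k : ℕ) (o : Option ℕ) : ℝ :=
  o.elim 0 (fun l => if l ≤ k then 2 else 2 ^ (ν k) * (2:ℝ) ^ (-(θ * l)))

theorem cc_none (θ : ℝ) (ν : ℕ → ℕ) (k : ℕ) : cc θ ν k none = 0 := rfl
theorem cc_some (θ : ℝ) (ν : ℕ → ℕ) (k l : ℕ) : cc θ ν k (some l) =
    if l ≤ k then 2 else 2 ^ (ν k) * (2:ℝ) ^ (-(θ * l)) := rfl

theorem count_core {L : ℕ → Option ℕ} {θ : ℝ} {A : ℕ → ℕ → ℝ} (ν : ℕ → ℕ)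
    (hA0 : ∀ n, 0 ≤ A n 0) (hmono : ∀ n m, A n m ≤ A n (m+1))
    (hstep : ∀ n m, A n (m+1) - A n m ≤ 2 ^ n * ww θ (L m) + 3 / 2 ^ (n + m + 1)) (k M : ℕ) :
    ∑ m ∈ Finset.range M, (if ⌊A (ν k) m⌋₊ < ⌊A (ν k) (m+1)⌋₊ then (1:ℝ) else 0) ≤
      4 + ∑ m ∈ Finset.range M, cc θ ν k (L m) := by
  have hpos : ∀ n m, 0 ≤ A n m := by
    intro n m
    induction m with
    | zero => exact hA0 n
    | succ m ih => exact ih.trans (hmono n m)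
  suffices h : ∑ m ∈ Finset.range M, (if ⌊A (ν k) m⌋₊ < ⌊A (ν k) (m+1)⌋₊ then (1:ℝ) else 0) +
      (A (ν k) M - ⌊A (ν k) M⌋₊) ≤ 4 - 3 / 2 ^ M + ∑ m ∈ Finset.range M, cc θ ν k (L m) by
    have h1 := Nat.floor_le (hpos (ν k) M)
    have h2 : (0:ℝ) < 3 / 2 ^ M := by positivity
    linarith
  induction M with
  | zero =>
    have := Nat.lt_floor_add_one (A (ν k) 0)
    simp only [Finset.range_zero, Finset.sum_empty, pow_zero]
    linarith
  | succ M ih =>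
    rw [Finset.sum_range_succ, Finset.sum_range_succ]
    have hM3 : (3:ℝ) / 2 ^ M = 2 * (3 / 2 ^ (M+1)) := by rw [pow_succ]; field_simp
    have hM4 : (3:ℝ) / 2 ^ (ν k + M + 1) ≤ 3 / 2 ^ (M + 1) := by
      apply div_le_div_of_nonneg_left (by norm_num) (by positivity)
      exact pow_le_pow_right₀ (by norm_num) (by omega)
    have hM5 : (0:ℝ) < 3 / 2 ^ (M + 1) := by positivity
    set a := A (ν k) M
    set b := A (ν k) (M+1)
    have hab : a ≤ b := hmono _ _
    have ha := Nat.floor_le (hpos (ν k) M)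
    have hb := Nat.lt_floor_add_one b
    have hfl : ⌊a⌋₊ ≤ ⌊b⌋₊ := Nat.floor_mono hab
    set t : ℝ := if ⌊a⌋₊ < ⌊b⌋₊ then (1:ℝ) else 0 with ht
    have key : t + (b - ⌊b⌋₊) ≤ (a - ⌊a⌋₊) + (b - a) := by
      rw [ht]; split_ifs with h
      · have : ((⌊a⌋₊ : ℝ)) + 1 ≤ ⌊b⌋₊ := by exact_mod_cast h
        linarith
      · have : ⌊a⌋₊ = ⌊b⌋₊ := by omega
        rw [this]; linarith
    have ht1 : t ≤ 1 := by rw [ht]; split_ifs <;> norm_num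
    have hst := hstep (ν k) M
    rcases hx : L M with _ | l
    · rw [hx, ww_none, mul_zero] at hst
      rw [cc_none]
      linarith
    · rw [hx, ww_some] at hst
      rw [cc_some]
      by_cases h : l ≤ k
      · rw [if_pos h]
        linarith
      · rw [if_neg h]
        linarith

theorem cc_bound {θ : ℝ} {ν : ℕ → ℕ} (hν : ∀ k : ℕ, |(ν k : ℝ) - θ * k| ≤ 3) (k l : ℕ) :
    (1/2) ^ k * cc θ ν k (some l) ≤
      if l ≤ k then 2 * ((1:ℝ)/2) ^ k else 8 * (1/2) ^ l * ((2:ℝ) ^ (-(θ - 1))) ^ (l - k) := by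
  simp only [cc, Option.elim]
  split_ifs with h
  · linarith
  · push Not at h
    have h2 : ∀ n : ℕ, ((1:ℝ)/2) ^ n = (2:ℝ) ^ (-(n:ℝ)) := by
      intro n
      rw [Real.rpow_neg (by norm_num), Real.rpow_natCast, one_div, inv_pow]
    rw [h2, h2, ← Real.rpow_natCast 2 (ν k), ← Real.rpow_natCast _ (l - k), ← Real.rpow_mul (by norm_num),
      show (8:ℝ) = 2 ^ (3:ℝ) by norm_num, ← Real.rpow_add (by norm_num), ← Real.rpow_add (by norm_num),
      ← Real.rpow_add (by norm_num), ← Real.rpow_add (by norm_num)]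
    apply Real.rpow_le_rpow_of_exponent_le (by norm_num)
    rw [Nat.cast_sub h.le]
    have := (abs_le.1 (hν k)).2
    nlinarith

theorem fssp_core {L : ℕ → Option ℕ} {θ Z : ℝ} (hθ : 1 < θ) (hZ : HasSum (fun i => ww θ (L i)) Z)
    (hk : ∀ M, ∑ i ∈ Finset.range M, wl (L i) ≤ 1) (hK : KCA L)
    {ν : ℕ → ℕ} (hνc : Computable ν) (hν : ∀ k : ℕ, |(ν k : ℝ) - θ * k| ≤ 3)
    {A : ℕ → ℕ → ℝ} (hA : Computable₂ (fun n m => ⌊A n m⌋₊))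
    (hA0 : ∀ n, A n 0 = 6 / 2 ^ n) (hmono : ∀ n m, A n m ≤ A n (m+1))
    (hstep : ∀ n m, A n (m+1) - A n m ≤ 2 ^ n * ww θ (L m) + 3 / 2 ^ (n + m + 1))
    (hlo : ∀ n m, 2 ^ n * ∑ i ∈ Finset.range m, ww θ (L i) + 3 / 2 ^ n ≤ A n m)
    (hhi : ∀ n m, A n m ≤ 2 ^ n * ∑ i ∈ Finset.range m, ww θ (L i) + 9 / 2 ^ n) :
    ∃ k N, ∀ n, N ≤ n → ∃ i, i < k ∧ binDigit Z (n+i) = true := by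
  have hA00 : ∀ n, 0 ≤ A n 0 := fun n => by rw [hA0]; positivity
  have hpos : ∀ n m, 0 ≤ A n m := by
    intro n m
    induction m with
    | zero => exact hA00 n
    | succ m ih => exact ih.trans (hmono n m)
  set ρ : ℝ := (2:ℝ) ^ (-(θ - 1)) with hρ
  have hρ0 : 0 < ρ := by positivity
  have hρ1 : ρ < 1 := Real.rpow_lt_one_of_one_lt_of_neg (by norm_num) (by linarith)
  set K : ℝ := 4 + 8 / (1 - ρ) with hKdef
  have hK0 : 0 ≤ K := by
    have : 0 < 1 - ρ := by linarith
    positivity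
  have hccsum : ∀ N m, ∑ k ∈ Finset.range N, (1/2) ^ k * cc θ ν k (L m) ≤ K * wl (L m) := by
    intro N m
    rcases L m with _ | l
    · simp [cc, wl_none]
    · rw [wl_some]
      exact (Finset.sum_le_sum fun k _ => cc_bound hν k l).trans (ell_sum hρ0 hρ1 l N)
  obtain ⟨c, hc⟩ := exists_pow_lt_of_lt_one (show 0 < 1 / 2 / (8 + K) by positivity)
    (show (1/2:ℝ) < 1 by norm_num)
  have hc' : ((1:ℝ)/2) ^ c * (8 + K) ≤ 1/2 := by
    rw [lt_div_iff₀ (by positivity)] at hc; exact hc.le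
  let tr : ℕ → ℕ → Bool := fun m k => decide (⌊A (ν k) m⌋₊ < ⌊A (ν k) (m+1)⌋₊)
  let len : ℕ → Option ℕ := fun r => bif tr r.unpair.1 r.unpair.2 then some (r.unpair.2 + c) else none
  have htr : Computable (fun x : ℕ × ℕ => tr x.1 x.2) := by
    have h1 : Computable (fun x : ℕ × ℕ => decide (x.1 < x.2)) := (Primrec.nat_lt.decide).to_comp
    have hn : Computable (fun x : ℕ × ℕ => ν x.2) := hνc.comp Computable.snd
    have h2 : Computable (fun x : ℕ × ℕ => ⌊A (ν x.2) x.1⌋₊) := hA.comp hn Computable.fst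
    have h3 : Computable (fun x : ℕ × ℕ => ⌊A (ν x.2) (x.1+1)⌋₊) :=
      hA.comp hn (Computable.succ.comp Computable.fst)
    have h4 : Computable (fun x : ℕ × ℕ => (⌊A (ν x.2) x.1⌋₊, ⌊A (ν x.2) (x.1+1)⌋₊)) := h2.pair h3
    exact h1.comp h4
  have hlen : Computable len := by
    have h1 : Computable (fun r : ℕ => tr r.unpair.1 r.unpair.2) := htr.comp Computable.unpair
    have h2 : Computable (fun r : ℕ => some (r.unpair.2 + c)) :=
      (Primrec.option_some.comp (Primrec.nat_add.comp (Primrec.snd.comp Primrec.unpair)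
        (Primrec.const c))).to_comp
    exact Computable.cond h1 h2 (Computable.const none)
  have hmm : Computable (fun r : ℕ => r.unpair.1 + 1) :=
    (Primrec.succ.comp (Primrec.fst.comp Primrec.unpair)).to_comp
  obtain ⟨d, hd⟩ := hK len (fun r => r.unpair.1 + 1) hlen hmm (by
    intro N
    let f : ℕ → ℕ → ℝ := fun m k => (1/2) ^ (k + c) *
      (if ⌊A (ν k) m⌋₊ < ⌊A (ν k) (m+1)⌋₊ then (1:ℝ) else 0)
    have hf : ∀ m k, 0 ≤ f m k := by
      intro m k; simp only [f]; split_ifs <;> positivity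
    have e : ∀ r, wl (len r) = f r.unpair.1 r.unpair.2 := by
      intro r
      simp only [len, tr, f]
      by_cases h : ⌊A (ν r.unpair.2) r.unpair.1⌋₊ < ⌊A (ν r.unpair.2) (r.unpair.1+1)⌋₊
      · rw [decide_eq_true h, if_pos h, cond_true, wl_some, mul_one]
      · rw [decide_eq_false h, if_neg h, cond_false, wl_none, mul_zero]
    rw [Finset.sum_congr rfl fun r _ => e r]
    refine (sum_unpair_le hf N).trans ?_
    have h1 : ∀ k ∈ Finset.range N, ∑ m ∈ Finset.range N, f m k ≤
        (1/2) ^ c * (4 * (1/2) ^ k + ∑ m ∈ Finset.range N, (1/2) ^ k * cc θ ν k (L m)) := by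
      intro k _
      simp only [f]
      rw [← Finset.mul_sum, ← Finset.mul_sum, pow_add]
      have := count_core ν hA00 hmono hstep k N
      calc _ ≤ ((1:ℝ)/2) ^ k * (1/2) ^ c * (4 + ∑ m ∈ Finset.range N, cc θ ν k (L m)) := by gcongr
        _ = _ := by ring
    refine (Finset.sum_le_sum h1).trans (le_trans ?_ hc')
    rw [← Finset.mul_sum, Finset.sum_add_distrib, Finset.sum_comm]
    refine mul_le_mul_of_nonneg_left (add_le_add ?_ ?_) (by positivity)
    · clear h1
      have : ∑ i ∈ Finset.range N, 4 * ((1:ℝ)/2) ^ i = 8 - 8 * (1/2) ^ N := by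
        induction N with
        | zero => simp
        | succ N ih => rw [Finset.sum_range_succ, ih, pow_succ]; ring
      have h2 : (0:ℝ) < 8 * (1/2) ^ N := by positivity
      linarith
    · refine (Finset.sum_le_sum fun m _ => hccsum N m).trans ?_
      rw [← Finset.mul_sum]
      exact mul_le_of_le_one_right hK0 (hk N))
  have hZ0 : 0 ≤ Z := hZ.nonneg (fun i => ww_nonneg _ _)
  have hZpos : 0 < Z := by
    -- the machine halts on some input
    obtain ⟨d', hd'⟩ := hK (fun r => some (r + 2)) (fun r => r)
      (Primrec.option_some.comp (Primrec.nat_add.comp Primrec.id (Primrec.const 2))).to_comp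
      Computable.id (by
        intro N
        have : ∑ r ∈ Finset.range N, wl (some (r + 2)) ≤ 1/2 - 1/2 * (1/2) ^ N := by
          induction N with
          | zero => simp
          | succ N ih =>
            rw [Finset.sum_range_succ, wl_some]
            rw [pow_succ, pow_add]; linarith
        have h2 : (0:ℝ) < (1/2) ^ N := by positivity
        linarith)
    obtain ⟨i, l', hi, hl, _⟩ := hd' 0 2 rfl
    have h1 := partial_add_le (fun i => ww_nonneg θ (L i)) hZ (Nat.zero_le i)
    rw [hl, ww_some] at h1
    simp only [Finset.range_zero, Finset.sum_empty] at h1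
    have : (0:ℝ) < 2 ^ (-(θ * l')) := by positivity
    linarith
  obtain ⟨g, hg⟩ := exists_nat_ge (6 + θ)
  set δ : ℝ := (2:ℝ) ^ (-(3 + θ * (c + d))) with hδ
  have hδ0 : 0 < δ := by positivity
  obtain ⟨k0, hk0⟩ := exists_pow_lt_of_lt_one (show 0 < δ / 2 by positivity) (show (1/2:ℝ) < 1 by norm_num)
  obtain ⟨N1, hN1⟩ := exists_pow_lt_of_lt_one (show 0 < δ / 18 by positivity) (show (1/2:ℝ) < 1 by norm_num)
  obtain ⟨N2, hN2⟩ := exists_pow_lt_of_lt_one hZpos (show (1/2:ℝ) < 1 by norm_num)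
  refine ⟨g + k0, N1 + N2 + 3, fun n hn => ?_⟩
  by_contra hcon
  push Not at hcon
  have hrun := floor_zero_run hZ0 n (g + k0) (fun i hi => by simpa using hcon i hi)
  have hFn : 1 ≤ ⌊Z * 2 ^ n⌋₊ := by
    rw [Nat.one_le_floor_iff]
    have h1 : ((1:ℝ)/2) ^ n ≤ (1/2) ^ N2 := pow_le_pow_of_le_one (by norm_num) (by norm_num) (by omega)
    have h2 : ((1:ℝ)/2) ^ n * 2 ^ n = 1 := by rw [← mul_pow]; norm_num
    have h3 : (0:ℝ) < 2 ^ n := by positivity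
    nlinarith
  -- choose the length
  set k := ⌈((n:ℝ) + 3) / θ⌉₊ with hkdef
  have hk1 : (n:ℝ) + 3 ≤ θ * k := by
    have := Nat.le_ceil (((n:ℝ) + 3) / θ)
    rw [div_le_iff₀ (by linarith)] at this
    linarith
  have hk2 : θ * k ≤ n + 3 + θ := by
    have := (Nat.ceil_lt_add_one (show 0 ≤ ((n:ℝ) + 3) / θ by positivity)).le
    have h2 := mul_le_mul_of_nonneg_left this (show 0 ≤ θ by linarith)
    rw [mul_add, mul_div_cancel₀ _ (by linarith : θ ≠ 0)] at h2
    linarith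
  have hνk := abs_le.1 (hν k)
  obtain ⟨t, ht⟩ : ∃ t, ν k = n + t := Nat.exists_eq_add_of_le (by
    have : (n:ℝ) ≤ ν k := by linarith
    exact_mod_cast this)
  have htg : t ≤ g := by
    have : (ν k : ℝ) ≤ n + g := by linarith
    rw [ht] at this; push_cast at this
    have : (t:ℝ) ≤ g := by linarith
    exact_mod_cast this
  set s := ν k with hs
  set F := ⌊Z * 2 ^ n⌋₊ with hF
  set a := 2 ^ t * F with ha
  have ha1 : 1 ≤ a := Nat.mul_pos (by positivity) hFn
  have haZ : (a:ℝ) ≤ Z * 2 ^ s := by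
    have h1 : (F:ℝ) ≤ Z * 2 ^ n := Nat.floor_le (by positivity)
    rw [ha, ht, pow_add]; push_cast
    have : (0:ℝ) < 2 ^ t := by positivity
    nlinarith
  have hZa : Z * 2 ^ s < a + δ / 2 := by
    have h1 := Nat.lt_floor_add_one (Z * 2 ^ (n + (g + k0)))
    rw [hrun] at h1
    push_cast at h1
    obtain ⟨t', rfl⟩ := Nat.exists_eq_add_of_le htg
    have e1 : Z * 2 ^ (n + (t + t' + k0)) = (Z * 2 ^ s) * (2 ^ t' * 2 ^ k0) := by
      rw [ht]; simp only [pow_add]; ring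
    have e2 : (2:ℝ) ^ (t + t' + k0) * F = a * (2 ^ t' * 2 ^ k0) := by
      rw [ha]; push_cast; simp only [pow_add]; ring
    rw [e1, e2] at h1
    have h3 : (1:ℝ) ≤ 2 ^ t' := one_le_pow₀ (by norm_num)
    have h4 : ((1:ℝ)/2) ^ k0 * 2 ^ k0 = 1 := by rw [← mul_pow]; norm_num
    have h5 : (0:ℝ) < 2 ^ k0 := by positivity
    have h6 : 1 ≤ δ / 2 * (2 ^ t' * 2 ^ k0) := by
      have h7 : 1 ≤ δ / 2 * 2 ^ k0 := by nlinarith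
      nlinarith
    have h8 : (Z * 2 ^ s) * (2 ^ t' * 2 ^ k0) < (a + δ / 2) * (2 ^ t' * 2 ^ k0) := by
      rw [add_mul]; linarith
    exact lt_of_mul_lt_mul_right h8 (by positivity)
  have hex : ∃ m, a ≤ ⌊A s m⌋₊ := by
    obtain ⟨m, hm⟩ := A_reach hZ hlo s
    exact ⟨m, Nat.le_floor (haZ.trans hm)⟩
  classical
  have hsp := Nat.find_spec hex
  have hmin := fun j hj => Nat.find_min hex (m := j) hj
  set m1 := Nat.find hex
  obtain _ | m := m1
  · exfalso
    have h1 : ⌊A s 0⌋₊ = 0 := by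
      rw [Nat.floor_eq_zero, hA0, div_lt_one (by positivity)]
      calc (6:ℝ) < 2 ^ 3 := by norm_num
        _ ≤ 2 ^ s := pow_le_pow_right₀ (by norm_num) (by omega)
    omega
  have hbelow : ⌊A s m⌋₊ < a := not_le.1 (hmin m (Nat.lt_succ_self m))
  have htrig : len (Nat.pair m k) = some (k + c) := by
    simp only [len, tr, Nat.unpair_pair]
    rw [decide_eq_true (show ⌊A (ν k) m⌋₊ < ⌊A (ν k) (m+1)⌋₊ from lt_of_lt_of_le hbelow hsp), cond_true]
  obtain ⟨i, l', hi, hl, hle⟩ := hd _ _ htrig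
  simp only [Nat.unpair_pair] at hi
  have h1 := partial_add_le (fun i => ww_nonneg θ (L i)) hZ hi
  rw [hl, ww_some] at h1
  have h2 := hhi s (m+1)
  have h3 : (a:ℝ) ≤ A s (m+1) := (Nat.cast_le.2 hsp).trans (Nat.floor_le (hpos s (m+1)))
  have h4 : δ ≤ 2 ^ s * (2:ℝ) ^ (-(θ * l')) := by
    rw [hδ, ← Real.rpow_natCast 2 s, ← Real.rpow_add (by norm_num)]
    apply Real.rpow_le_rpow_of_exponent_le (by norm_num)
    have h5 : (l' : ℝ) ≤ k + c + d := by exact_mod_cast hle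
    have h6 : θ * l' ≤ θ * (k + c + d) := mul_le_mul_of_nonneg_left h5 (by linarith)
    linarith
  have h7 : (9:ℝ) / 2 ^ s < δ / 2 := by
    have e1 : (9:ℝ) / 2 ^ s = 9 * (1/2) ^ s := by
      rw [one_div, inv_pow]; rfl
    have e2 : ((1:ℝ)/2) ^ s ≤ (1/2) ^ N1 := pow_le_pow_of_le_one (by norm_num) (by norm_num) (by omega)
    rw [e1]; linarith
  have h8 : (0:ℝ) < 2 ^ s := by positivity
  have h9 := mul_le_mul_of_nonneg_left h1 h8.le
  rw [mul_add] at h9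
  linarith

theorem kca_of_optimal {U : List Bool →. List Bool} (hU : IsOptimalMachine U) {L : ℕ → Option ℕ}
    {o : ℕ → List Bool} (ho : Computable o)
    (h : ∀ m q, o m ∈ U q → ∃ i, m ≤ i ∧ L i = some q.length) : KCA L := by
  intro len mm hlen hmm hs
  obtain ⟨d, hd⟩ := kc_optimal hU len (fun r => o (mm r)) hlen (ho.comp hmm) hs
  refine ⟨d, fun r l hr => ?_⟩
  obtain ⟨q, hq, hm⟩ := hd r l hr
  obtain ⟨i, hi, hL⟩ := h _ _ hm
  exact ⟨i, q.length, hi, hL, hq⟩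

theorem main_aux (U : List Bool →. List Bool) (hU : IsOptimalMachine U) (T : ℝ) (h0 : 0 < T) (h1 : T < 1)
    (hT : ComputableReal T) :
    FiniteStateStronglyPredictable (fun n => binDigit (ZT U T) n) ∧
      ¬ Computable (fun n => binDigit (ZT U T) n) := by
  obtain ⟨L, o, hL, ho, hk, hZ, hq⟩ := exists_enum2 hU.1
  have hK := kca_of_optimal hU ho hq
  obtain ⟨A, hA, hA0, hmono, hstep, hlo, hhi⟩ := exists_A hL h0 h1 hT
  obtain ⟨-, ν, hνc, hν⟩ := exists_G h0 h1 hT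
  have hθ : 1 < 1 / T := by rw [lt_div_iff₀ h0]; linarith
  refine ⟨fssp_of_no_zero_run _ ?_, not_computable_core (by linarith) (hZ T h0 h1) hK hA hlo hhi⟩
  exact fssp_core hθ (hZ T h0 h1) hk hK hνc hν hA hA0 hmono hstep hlo hhi

theorem exists_fssp_not_computable
    (U : List Bool →. List Bool) (hU : IsOptimalMachine U) :
    (∃ X : ℕ → Bool, FiniteStateStronglyPredictable X ∧ ¬ Computable X) ∧
      ∀ T : ℝ, 0 < T → T < 1 → ComputableReal T →
        FiniteStateStronglyPredictable (fun n => binDigit (ZT U T) n) ∧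
          ¬ Computable (fun n => binDigit (ZT U T) n) := by
  refine ⟨?_, fun T h0 h1 hT => main_aux U hU T h0 h1 hT⟩
  refine ⟨_, main_aux U hU (1/2) (by norm_num) (by norm_num) ⟨fun _ => 1/2, Computable.const _, fun n => ?_⟩⟩
  have : (0:ℝ) < 2 ^ (-(n:ℤ)) := by positivity
  simpa using this
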